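/- arXiv:1912.07102 — 4 statements merged into one kernel-verified Lean document; each statement's English description precedes it below -/
import Mathlib

section
/- Let p be a prime and q = p^n. Then K(GL_2(F_q)) = ℚ(ζ_{q−1}, {ζ_{q²−1}^r + ζ_{q²−1}^{qr} : 1 ≤ r ≤ (q² − 1)/2}). -/
open CategoryTheory

/-- `zeta N` is the root of unity `e^{2 π i / N}`. -/
noncomputable def zeta (N : ℕ) : ℂ := Complex.exp (2 * Real.pi * Complex.I / N)

/-- `charField G` is the field `K(G)` generated over `ℚ` by all values of
irreducible complex characters of `G`. -/
noncomputable def charField (G : Type) [Group G] : IntermediateField ℚ ℂ :=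
  IntermediateField.adjoin ℚ
    {x : ℂ | ∃ V : FDRep ℂ G, Simple V ∧ ∃ g : G, V.character g = x}

/-- `charFieldAt G d` is the field `K_d(G)` generated over `ℚ` by the values of
irreducible complex characters of `G` at elements of order exactly `d`. -/
noncomputable def charFieldAt (G : Type) [Group G] (d : ℕ) : IntermediateField ℚ ℂ :=
  IntermediateField.adjoin ℚ
    {x : ℂ | ∃ V : FDRep ℂ G, Simple V ∧ ∃ g : G, orderOf g = d ∧ V.character g = x}

namespace Representation

variable {G V : Type} [Group G] [Fintype G] [AddCommGroup V] [Module ℂ V] [FiniteDimensional ℂ V]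

theorem IsIrreducible.simple_fdRep_of (ρ : Representation ℂ G V) [ρ.IsIrreducible] :
    Simple (FDRep.of ρ) := by
  have : Invertible (Nat.card G : ℂ) := invertibleOfNonzero (by simp)
  rw [FDRep.simple_iff_char_is_norm_one]
  have h := char_orthonormal ρ ρ
  rw [if_pos ⟨Equiv.refl ρ⟩, inv_mul_eq_one₀ (by simp)] at h
  exact h.symm

omit [FiniteDimensional ℂ V] in
/-- Maschke's theorem, for subrepresentations. -/
theorem isSemisimpleRepresentation_of_finite (ρ : Representation ℂ G V) :
    ρ.IsSemisimpleRepresentation := by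
  have : NeZero (Nat.card G : ℂ) := ⟨by simp⟩
  rw [isSemisimpleRepresentation_iff_isSemisimpleModule_asModule]
  infer_instance

omit [Fintype G] in
theorem trace_eq_add_of_isCompl (ρ : Representation ℂ G V) {σ τ : Subrepresentation ρ}
    (h : IsCompl σ τ) (g : G) :
    LinearMap.trace ℂ V (ρ g) = LinearMap.trace ℂ σ.toSubmodule (σ.toRepresentation g) +
      LinearMap.trace ℂ τ.toSubmodule (τ.toRepresentation g) := by
  have hc : IsCompl σ.toSubmodule τ.toSubmodule := by
    constructor
    · rw [disjoint_iff, ← Subrepresentation.toSubmodule_inf, h.inf_eq_bot]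
      rfl
    · rw [codisjoint_iff, ← Subrepresentation.toSubmodule_sup, h.sup_eq_top]
      rfl
  have hi := (DirectSum.isInternal_submodule_iff_isCompl
    (fun b : Bool ↦ bif b then σ.toSubmodule else τ.toSubmodule) (i := true) (j := false)
    (by simp) (by ext b; cases b <;> simp)).2 hc
  rw [LinearMap.trace_eq_sum_trace_restrict hi (f := ρ g), Fintype.sum_bool]
  · rfl
  · rintro (_ | _)
    · exact fun x hx ↦ τ.apply_mem_toSubmodule g hx
    · exact fun x hx ↦ σ.apply_mem_toSubmodule g hx

/-- The values of every complex character, irreducible or not, lie in the character field. -/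
theorem trace_mem_charField (ρ : Representation ℂ G V) (g : G) :
    LinearMap.trace ℂ V (ρ g) ∈ charField G := by
  induction hn : Module.finrank ℂ V using Nat.strong_induction_on generalizing V with
  | _ n ih =>
    subst hn
    rcases subsingleton_or_nontrivial V with hV | hV
    · rw [Subsingleton.elim (ρ g) 0, map_zero]
      exact zero_mem _
    by_cases hρ : ρ.IsIrreducible
    · exact IntermediateField.subset_adjoin _ _
        ⟨FDRep.of ρ, IsIrreducible.simple_fdRep_of ρ, g, rfl⟩
    have : Nontrivial (Subrepresentation ρ) := by
      refine ⟨⊥, ⊤, fun h ↦ bot_ne_top (α := Submodule ℂ V) ?_⟩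
      exact congrArg Subrepresentation.toSubmodule h
    obtain ⟨σ, hσb, hσt⟩ : ∃ σ : Subrepresentation ρ, σ ≠ ⊥ ∧ σ ≠ ⊤ := by
      by_contra! h
      exact hρ ⟨fun a ↦ or_iff_not_imp_left.2 (h a)⟩
    have := isSemisimpleRepresentation_of_finite ρ
    obtain ⟨τ, hτ⟩ := exists_isCompl σ
    have lt_of_ne_top {α : Subrepresentation ρ} (hα : α ≠ ⊤) :
        Module.finrank ℂ α.toSubmodule < Module.finrank ℂ V :=
      Submodule.finrank_lt fun h ↦ hα (Subrepresentation.toSubmodule_injective h)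
    rw [trace_eq_add_of_isCompl ρ hτ]
    refine add_mem (ih _ (lt_of_ne_top hσt) _ rfl) (ih _ (lt_of_ne_top ?_) _ rfl)
    rintro rfl
    exact hσb (by simpa using hτ.inf_eq_bot)

end Representation

section Induced

variable {G : Type} [Group G] [Fintype G]

/-- The action of `G` on functions `G → ℂ` by left translation. -/
noncomputable def leftTranslation (G : Type) [Group G] : Representation ℂ G (G → ℂ) where
  toFun g := LinearMap.funLeft ℂ ℂ fun x ↦ g⁻¹ * x
  map_one' := by ext; simp [LinearMap.funLeft]
  map_mul' a b := by ext; simp [LinearMap.funLeft, mul_assoc]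

/-- The unnormalised projection onto the `c⁻¹`-eigenspace of right translation by `w`. -/
noncomputable def twistedSum (w : G) (c : ℂ) (N : ℕ) : (G → ℂ) →ₗ[ℂ] (G → ℂ) :=
  ∑ j ∈ Finset.range N, c ^ j • LinearMap.funLeft ℂ ℂ fun x ↦ x * w ^ j

omit [Fintype G] in
theorem twistedSum_apply (w : G) (c : ℂ) (N : ℕ) (f : G → ℂ) (x : G) :
    twistedSum w c N f x = ∑ j ∈ Finset.range N, c ^ j * f (x * w ^ j) := by
  simp [twistedSum, LinearMap.funLeft]

omit [Fintype G] in
theorem mul_twistedSum_apply_mul {w : G} {c : ℂ} {N : ℕ} (hw : w ^ N = 1) (hc : c ^ N = 1)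
    (f : G → ℂ) (x : G) : c * twistedSum w c N f (x * w) = twistedSum w c N f x := by
  have h := Finset.sum_range_succ (fun j ↦ c ^ j * f (x * w ^ j)) N
  rw [Finset.sum_range_succ'] at h
  simp only [hw, hc, pow_zero, add_left_inj] at h
  rw [twistedSum_apply, twistedSum_apply, ← h, Finset.mul_sum]
  refine Finset.sum_congr rfl fun j _ ↦ ?_
  rw [pow_succ', pow_succ', mul_assoc, mul_assoc]

/-- The functions transforming by `c⁻¹` under right translation by `w`, as a model of an induced
representation. -/
noncomputable def twistedFunctions (w : G) (c : ℂ) : Subrepresentation (leftTranslation G) where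
  toSubmodule :=
    { carrier := {f | ∀ x, c * f (x * w) = f x}
      add_mem' := fun {f f'} hf hf' x ↦ by
        simp only [Set.mem_ofPred_eq, Pi.add_apply, mul_add] at *
        rw [hf, hf']
      zero_mem' := by simp
      smul_mem' := fun a f hf x ↦ by
        simp only [Set.mem_ofPred_eq, Pi.smul_apply, smul_eq_mul] at *
        rw [← hf x]; ring }
  apply_mem_toSubmodule g f hf x := by
    have := hf (g⁻¹ * x)
    rwa [mul_assoc] at this

omit [Group G] in
theorem trace_funLeft (σ : G → G) :
    LinearMap.trace ℂ (G → ℂ) (LinearMap.funLeft ℂ ℂ σ) = Nat.card {x // σ x = x} := by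
  classical
  rw [LinearMap.trace_eq_matrix_trace ℂ (Pi.basisFun ℂ G), Matrix.trace]
  simp [LinearMap.funLeft, Pi.single_apply, Fintype.card_subtype]

/-- The character values of the representation induced from a character of a cyclic subgroup,
up to normalisation. -/
theorem sum_pow_mul_card_mem_charField {w : G} {c : ℂ} {N : ℕ} (hw : w ^ N = 1)
    (hc : c ^ N = 1) (g : G) :
    ∑ j ∈ Finset.range N, c ^ j * Nat.card {x : G // g⁻¹ * x * w ^ j = x} ∈ charField G := by
  set W := twistedFunctions w c
  have hmem (f) : (leftTranslation G g ∘ₗ twistedSum w c N) f ∈ W.toSubmodule :=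
    W.apply_mem_toSubmodule g (mul_twistedSum_apply_mul hw hc f)
  have hrestrict : (leftTranslation G g ∘ₗ twistedSum w c N).restrict (fun f _ ↦ hmem f) =
      (N : ℂ) • W.toRepresentation g := by
    have key (f : G → ℂ) (hf : f ∈ W.toSubmodule) : twistedSum w c N f = (N : ℂ) • f := by
      ext x
      have hj (j : ℕ) : c ^ j * f (x * w ^ j) = f x := by
        induction j with
        | zero => simp
        | succ j ih =>
          rw [pow_succ, pow_succ, ← mul_assoc, mul_assoc, ← ih]
          exact congrArg _ (hf _)
      simp [twistedSum_apply, hj]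
    ext f : 2
    simp only [LinearMap.coe_restrict_apply, LinearMap.comp_apply, key f.1 f.2, map_smul]
    rfl
  have htrace := LinearMap.trace_restrict_eq_of_forall_mem W.toSubmodule _ hmem
  rw [hrestrict, map_smul] at htrace
  have hsum : LinearMap.trace ℂ _ (leftTranslation G g ∘ₗ twistedSum w c N) =
      ∑ j ∈ Finset.range N, c ^ j * Nat.card {x : G // g⁻¹ * x * w ^ j = x} := by
    rw [twistedSum, ← Module.End.mul_eq_comp, Finset.mul_sum, map_sum]
    refine Finset.sum_congr rfl fun j _ ↦ ?_
    rw [mul_smul_comm, map_smul, smul_eq_mul, ← trace_funLeft]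
    rfl
  rw [← hsum, ← htrace]
  exact mul_mem (natCast_mem _ N) (Representation.trace_mem_charField _ g)

end Induced

section GLTwo

open Polynomial

variable {F : Type} [Field F]

/-- A non-scalar two-by-two matrix is similar to the companion matrix of its characteristic
polynomial. -/
theorem Matrix.exists_mul_eq_mul_companion_of_ne_algebraMap (M : Matrix (Fin 2) (Fin 2) F)
    (hM : ∀ a : F, M ≠ algebraMap F _ a) :
    ∃ P : GL (Fin 2) F, M * P.1 = P.1 * !![0, -M.det; 1, M.trace] := by
  have key (P : Matrix (Fin 2) (Fin 2) F) (hP : P.det ≠ 0)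
      (h : M * P = P * !![0, -M.det; 1, M.trace]) :
      ∃ P : GL (Fin 2) F, M * P.1 = P.1 * !![0, -M.det; 1, M.trace] :=
    ⟨Matrix.GeneralLinearGroup.mkOfDetNeZero P hP, h⟩
  by_cases h10 : M 1 0 = 0
  · by_cases h01 : M 0 1 = 0
    · have hd : M 1 1 - M 0 0 ≠ 0 := by
        refine fun h ↦ hM (M 0 0) ?_
        ext i j
        fin_cases i <;> fin_cases j <;>
          simp [h10, h01, Matrix.algebraMap_matrix_apply, sub_eq_zero.1 h]
      refine key !![1, M 0 0; 1, M 1 1] (by simpa [Matrix.det_fin_two] using hd) ?_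
      ext i j
      fin_cases i <;> fin_cases j <;>
        simp [Matrix.mul_apply, Fin.sum_univ_two, Matrix.det_fin_two, Matrix.trace_fin_two, h10,
          h01] <;> ring
    · refine key !![0, M 0 1; 1, M 1 1] (by simpa [Matrix.det_fin_two] using h01) ?_
      ext i j
      fin_cases i <;> fin_cases j <;>
        simp [Matrix.mul_apply, Fin.sum_univ_two, Matrix.det_fin_two, Matrix.trace_fin_two, h10] <;>
        ring
  · refine key !![1, M 0 0; 0, M 1 0] (by simpa [Matrix.det_fin_two] using h10) ?_
    ext i j
    fin_cases i <;> fin_cases j <;>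
      simp [Matrix.mul_apply, Fin.sum_univ_two, Matrix.det_fin_two, Matrix.trace_fin_two] <;> ring

theorem Matrix.GeneralLinearGroup.isConj_of_trace_eq_of_det_eq {g h : GL (Fin 2) F}
    (hg : ∀ a : F, g.1 ≠ algebraMap F _ a) (hh : ∀ a : F, h.1 ≠ algebraMap F _ a)
    (htrace : g.1.trace = h.1.trace) (hdet : g.1.det = h.1.det) : IsConj g h := by
  obtain ⟨P, hP⟩ := Matrix.exists_mul_eq_mul_companion_of_ne_algebraMap g.1 hg
  obtain ⟨Q, hQ⟩ := Matrix.exists_mul_eq_mul_companion_of_ne_algebraMap h.1 hh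
  rw [← htrace, ← hdet] at hQ
  rw [isConj_iff]
  refine ⟨Q * P⁻¹, ?_⟩
  have hP' : g.1 = P.1 * !![0, -g.1.det; 1, g.1.trace] * (P⁻¹).1 := by
    rw [← hP, mul_assoc, ← Units.val_mul, mul_inv_cancel, Units.val_one, mul_one]
  have hQ' : h.1 = Q.1 * !![0, -g.1.det; 1, g.1.trace] * (Q⁻¹).1 := by
    rw [← hQ, mul_assoc, ← Units.val_mul, mul_inv_cancel, Units.val_one, mul_one]
  ext1
  rw [hQ', _root_.mul_inv_rev, inv_inv, Units.val_mul, Units.val_mul, Units.val_mul, Units.val_mul]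
  conv_lhs => rw [hP']
  have hPP : (P⁻¹).1 * P.1 = 1 := by rw [← Units.val_mul, inv_mul_cancel, Units.val_one]
  simp only [mul_assoc]
  rw [← mul_assoc (P⁻¹).1 P.1, hPP, one_mul, ← mul_assoc (P⁻¹).1 P.1, hPP, one_mul]

variable [Fintype F]

namespace Matrix.GeneralLinearGroup

/-- An invertible matrix with irreducible characteristic polynomial is conjugate to its Frobenius
power. -/
theorem isConj_pow_card_of_irreducible (g : GL (Fin 2) F) (hg : Irreducible g.1.charpoly) :
    IsConj g (g ^ Fintype.card F) := by
  have not_scalar (h : GL (Fin 2) F) (hh : h.1.charpoly = g.1.charpoly) (a : F) :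
      h.1 ≠ algebraMap F _ a := by
    intro ha
    have hroot : g.1.charpoly.IsRoot a := by
      rw [← hh, Polynomial.IsRoot, Matrix.eval_charpoly, ha]
      simp [Matrix.det_fin_two, Matrix.algebraMap_matrix_apply]
    have := Polynomial.degree_eq_one_of_irreducible_of_root hg hroot
    rw [Matrix.charpoly_degree_eq_dim] at this
    simp at this
  have hpow : (g ^ Fintype.card F).1.charpoly = g.1.charpoly := by
    rw [Units.val_pow_eq_pow_val, FiniteField.Matrix.charpoly_pow_card]
  refine isConj_of_trace_eq_of_det_eq (not_scalar g rfl) (not_scalar _ hpow) ?_ ?_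
  · rw [Matrix.trace_eq_neg_charpoly_nextCoeff, Matrix.trace_eq_neg_charpoly_nextCoeff, hpow]
  · rw [Matrix.det_eq_sign_charpoly_coeff, Matrix.det_eq_sign_charpoly_coeff, hpow]

/-- Either `g` is semisimple, or it is a scalar plus a nilpotent. -/
theorem isConj_pow_card_or_sub_sq_eq_zero (g : GL (Fin 2) F) :
    (g ^ (Fintype.card F ^ 2 - 1) = 1 ∧ IsConj g (g ^ Fintype.card F)) ∨
      ∃ a : F, (g.1 - algebraMap F _ a) ^ 2 = 0 := by
  have hcard : 1 < Fintype.card F := Fintype.one_lt_card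
  have hself := Matrix.aeval_self_charpoly g.1
  by_cases hroot : ∃ a, g.1.charpoly.IsRoot a
  · obtain ⟨a, ha⟩ := hroot
    set b := g.1.trace - a with hb
    have hfac : g.1.charpoly = (X - C a) * (X - C b) := by
      rw [Matrix.charpoly_fin_two] at ha ⊢
      simp only [IsRoot.def, eval_add, eval_sub, eval_pow, eval_X, eval_mul, eval_C] at ha
      have hdet : g.1.det = a * b := by rw [hb]; linear_combination ha
      have htr : g.1.trace = a + b := by rw [hb]; ring
      rw [hdet, htr, C_add, C_mul]
      ring
    by_cases hab : a = b
    · refine Or.inr ⟨a, ?_⟩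
      rw [hfac, ← hab] at hself
      simpa [sq] using hself
    · have hdvd : g.1.charpoly ∣ X ^ Fintype.card F - X := by
        rw [hfac]
        refine IsCoprime.mul_dvd (isCoprime_X_sub_C_of_isUnit_sub (sub_ne_zero.2 hab).isUnit) ?_ ?_
          <;> simp [dvd_iff_isRoot, FiniteField.pow_card]
      have hgq : g ^ Fintype.card F = g := by
        obtain ⟨Q, hQ⟩ := hdvd
        have := congrArg (aeval g.1) hQ
        rw [map_mul, hself, zero_mul, map_sub, map_pow, aeval_X, sub_eq_zero] at this
        ext1
        rwa [Units.val_pow_eq_pow_val]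
      refine Or.inl ⟨?_, by rw [hgq]⟩
      have h1 : g ^ (Fintype.card F - 1) = 1 := by
        rw [← mul_left_inj g, ← pow_succ, Nat.sub_add_cancel hcard.le, hgq, one_mul]
      obtain ⟨k, hk⟩ := Nat.sub_dvd_pow_sub_pow (Fintype.card F) 1 2
      rw [one_pow] at hk
      rw [hk, pow_mul, h1, one_pow]
  · push Not at hroot
    have hdeg : g.1.charpoly.natDegree = 2 := by simp [Matrix.charpoly_natDegree_eq_dim]
    have hirr : Irreducible g.1.charpoly := by
      refine irreducible_of_degree_le_three_of_not_isRoot ?_ hroot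
      simp [hdeg]
    refine Or.inl ⟨?_, isConj_pow_card_of_irreducible g hirr⟩
    obtain ⟨Q, hQ⟩ := (hirr.natDegree_dvd_iff_dvd_X_pow_card_pow_sub_X (n := 2)).1 hdeg.dvd
    have := congrArg (aeval g.1) hQ
    rw [map_mul, hself, zero_mul, map_sub, map_pow, aeval_X, sub_eq_zero,
      Nat.card_eq_fintype_card, ← Units.val_pow_eq_pow_val, Units.val_inj] at this
    rw [← mul_left_inj g, ← pow_succ, Nat.sub_add_cancel (Nat.one_le_pow _ _ (by lia)), this,
      one_mul]

theorem pow_eq_of_sub_sq_eq_zero {g : GL (Fin 2) F} {a : F}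
    (h : (g.1 - algebraMap F _ a) ^ 2 = 0) (i : ℕ) :
    (g ^ ((Fintype.card F - 1) * i + 1)).1 =
      algebraMap F _ a + (1 - i : F) • (g.1 - algebraMap F _ a) := by
  set N := g.1 - algebraMap F _ a with hN
  have hgN : g.1 = algebraMap F _ a + N := by rw [hN]; abel
  have ha : a ≠ 0 := by
    rintro rfl
    have := congrArg Matrix.det h
    rw [Matrix.det_pow, hN, map_zero, sub_zero] at this
    simp [g.det_ne_zero] at this
  have key (m : ℕ) : g.1 ^ (m + 1) =
      algebraMap F _ (a ^ (m + 1)) + ((m + 1) * a ^ m : F) • N := by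
    induction m with
    | zero => simp [← hgN]
    | succ m ih =>
      have hNN : N * N = 0 := by rw [← sq, h]
      have step (s t : F) : (algebraMap F _ s + t • N) * (algebraMap F _ a + N) =
          algebraMap F _ (s * a) + (s + t * a) • N := by
        rw [add_mul, mul_add, mul_add, smul_mul_assoc t N N, hNN, smul_zero, add_zero,
          smul_mul_assoc, ← Algebra.commutes a N, ← Algebra.smul_def s N, ← Algebra.smul_def a N,
          ← map_mul, smul_smul, add_assoc, ← add_smul]
      rw [pow_succ, ih]
      conv_lhs => rw [hgN]
      rw [step, ← pow_succ]
      push_cast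
      congr 2
      ring
  rw [Units.val_pow_eq_pow_val, key, pow_succ, pow_mul, FiniteField.pow_card_sub_one_eq_one a ha,
    one_pow, one_mul, mul_one]
  have : ((Fintype.card F - 1 : ℕ) : F) = -1 := by
    rw [Nat.cast_sub Fintype.card_pos, FiniteField.cast_card_eq_zero]
    simp
  rw [Nat.cast_mul, this]
  congr 2
  ring

theorem isConj_pow_of_sub_sq_eq_zero {g : GL (Fin 2) F} {a : F}
    (h : (g.1 - algebraMap F _ a) ^ 2 = 0) {i : ℕ} (hi : (i : F) ≠ 1) :
    IsConj g (g ^ ((Fintype.card F - 1) * i + 1)) := by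
  have hpow := pow_eq_of_sub_sq_eq_zero h i
  by_cases hN : g.1 - algebraMap F _ a = 0
  · suffices g ^ ((Fintype.card F - 1) * i + 1) = g by rw [this]
    ext1
    rw [hpow, hN, smul_zero, add_zero, ← sub_eq_zero.1 hN]
  have not_scalar (c : F) (hc : c ≠ 0) (b : F) :
      algebraMap F _ a + c • (g.1 - algebraMap F _ a) ≠ algebraMap F _ b := by
    intro hb
    have h1 : g.1 - algebraMap F _ a = algebraMap F _ (c⁻¹ * (b - a)) := by
      rw [map_mul, map_sub, ← hb, add_sub_cancel_left, ← Algebra.smul_def, inv_smul_smul₀ hc]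
    rw [h1, ← map_pow, map_eq_zero_iff _ (algebraMap F (Matrix (Fin 2) (Fin 2) F)).injective,
      sq_eq_zero_iff] at h
    rw [h, map_zero] at h1
    exact hN h1
  refine isConj_of_trace_eq_of_det_eq ?_ ?_ ?_ ?_
  · simpa using not_scalar 1 one_ne_zero
  · rw [hpow]
    exact not_scalar _ (sub_ne_zero.2 hi.symm)
  · have : (g.1 - algebraMap F _ a).trace = 0 :=
      (Matrix.isNilpotent_trace_of_isNilpotent ⟨2, h⟩).eq_zero
    rw [hpow, Matrix.trace_add, Matrix.trace_smul, this, smul_zero, add_zero, ← sub_eq_zero,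
      ← Matrix.trace_sub, this]
  · rw [Units.val_pow_eq_pow_val, Matrix.det_pow, pow_succ, pow_mul,
      FiniteField.pow_card_sub_one_eq_one _ g.det_ne_zero, one_pow, one_mul]

theorem pow_char_mul_eq_one_of_sub_sq_eq_zero {g : GL (Fin 2) F} {a : F}
    (h : (g.1 - algebraMap F _ a) ^ 2 = 0) (p : ℕ) [CharP F p] :
    g ^ ((Fintype.card F - 1) * p) = 1 := by
  have := pow_eq_of_sub_sq_eq_zero h p
  rw [CharP.cast_eq_zero, sub_zero, one_smul, add_sub_cancel, Units.val_inj, pow_succ] at this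
  simpa using this

end Matrix.GeneralLinearGroup

end GLTwo

section UpperBound

open Polynomial

theorem LinearMap.trace_aeval_mem_of_pow_eq_one {V : Type} [AddCommGroup V] [Module ℂ V]
    [FiniteDimensional ℂ V] {f : Module.End ℂ V} {N : ℕ} (hf : f ^ N = 1) (P : ℂ[X])
    (L : IntermediateField ℚ ℂ) (hP : ∀ c : ℂ, c ^ N = 1 → P.eval c ∈ L) :
    LinearMap.trace ℂ V (aeval f P) ∈ L := by
  rcases subsingleton_or_nontrivial V with hV | hV
  · rw [Subsingleton.elim (aeval f P) 0, map_zero]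
    exact zero_mem _
  rw [Module.End.trace_eq_sum_roots_charpoly_of_splits (IsAlgClosed.splits _)]
  refine multiset_sum_mem _ fun x hx ↦ ?_
  have hx' : x ∈ spectrum ℂ (aeval f P) := by
    rw [← Module.End.hasEigenvalue_iff_mem_spectrum, Module.End.hasEigenvalue_iff_isRoot_charpoly]
    exact isRoot_of_mem_roots hx
  rw [spectrum.map_polynomial_aeval_of_nonempty f P
    (spectrum.nonempty_of_isAlgClosed_of_finiteDimensional ℂ f)] at hx'
  obtain ⟨c, hc, rfl⟩ := hx'
  have hcN := spectrum.pow_mem_pow f N hc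
  rw [hf, spectrum.one_eq, Set.mem_singleton_iff] at hcN
  exact hP c hcN

variable {F : Type} [Field F] [Fintype F]

theorem charField_GL_two_le {p : ℕ} [Fact p.Prime] [CharP F p] (L : IntermediateField ℚ ℂ)
    (hsplit : ∀ c : ℂ, c ^ (Fintype.card F - 1) = 1 → c ∈ L)
    (htorus : ∀ c : ℂ, c ^ (Fintype.card F ^ 2 - 1) = 1 → c + c ^ Fintype.card F ∈ L) :
    charField (GL (Fin 2) F) ≤ L := by
  rw [charField, IntermediateField.adjoin_le_iff]
  rintro _ ⟨V, -, g, rfl⟩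
  have hconj {h : GL (Fin 2) F} (hh : IsConj g h) : V.character h = V.character g := by
    obtain ⟨c, rfl⟩ := isConj_iff.1 hh
    exact V.char_conj g c
  have hρ (m : ℕ) : LinearMap.trace ℂ V (V.ρ g ^ m) = V.character (g ^ m) := by
    rw [← map_pow]
    rfl
  rcases g.isConj_pow_card_or_sub_sq_eq_zero with ⟨hg, hgq⟩ | ⟨a, ha⟩
  · have := LinearMap.trace_aeval_mem_of_pow_eq_one (by rw [← map_pow, hg, map_one])
      (X + X ^ Fintype.card F) L (f := V.ρ g) (fun c hc ↦ by simpa using htorus c hc)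
    rw [map_add, map_pow, aeval_X, map_add, hρ, hconj hgq] at this
    change V.character g + V.character g ∈ L at this
    rw [← two_mul] at this
    simpa using mul_mem (inv_mem (ofNat_mem L 2)) this
  · have hg := g.pow_char_mul_eq_one_of_sub_sq_eq_zero ha p
    have hp : p.Prime := Fact.out
    have hq : Fintype.card F - 1 + 1 = Fintype.card F := Nat.sub_add_cancel Fintype.card_pos
    have hρg : V.ρ g ^ ((Fintype.card F - 1) * p) = 1 := by rw [← map_pow, hg, map_one]
    obtain ⟨k, hk⟩ : p ∣ Fintype.card F :=
      (CharP.cast_eq_zero_iff F p _).1 (FiniteField.cast_card_eq_zero F)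
    have hcard := LinearMap.trace_aeval_mem_of_pow_eq_one hρg (X ^ Fintype.card F) L
      fun c hc ↦ hsplit _ <| by
        have : Fintype.card F * (Fintype.card F - 1) = (Fintype.card F - 1) * p * k := by
          rw [mul_assoc, ← hk, mul_comm]
        rw [eval_pow, eval_X, ← pow_mul, this, pow_mul, hc, one_pow]
    have hsum := LinearMap.trace_aeval_mem_of_pow_eq_one hρg
      (∑ i ∈ Finset.range p, X ^ ((Fintype.card F - 1) * i + 1)) L fun c hc ↦ by
        simp only [eval_finsetSum, eval_pow, eval_X]
        simp only [pow_succ, pow_mul, ← Finset.sum_mul]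
        rw [pow_mul] at hc
        by_cases h1 : c ^ (Fintype.card F - 1) = 1
        · simpa [h1] using mul_mem (natCast_mem L p) (hsplit c h1)
        · rw [geom_sum_eq h1, hc]
          simp
    simp only [map_sum, map_pow, aeval_X, hρ] at hcard hsum
    rw [← Finset.add_sum_erase _ _ (Finset.mem_range.2 hp.one_lt), mul_one, hq] at hsum
    replace hsum := sub_mem hsum hcard
    rw [add_sub_cancel_left, Finset.sum_congr rfl (g := fun _ ↦ V.character g)] at hsum
    · rw [Finset.sum_const, Finset.card_erase_of_mem (Finset.mem_range.2 hp.one_lt),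
        Finset.card_range, nsmul_eq_mul] at hsum
      have hne : ((p - 1 : ℕ) : ℂ) ≠ 0 := Nat.cast_ne_zero.2 (Nat.sub_ne_zero_of_lt hp.one_lt)
      simpa [hne] using mul_mem (inv_mem (natCast_mem L (p - 1))) hsum
    · intro i hi
      rw [Finset.mem_erase, Finset.mem_range] at hi
      refine hconj (Matrix.GeneralLinearGroup.isConj_pow_of_sub_sq_eq_zero ha fun h ↦ hi.1 ?_)
      exact CharP.natCast_injOn_Iio F p hi.2 hp.one_lt (by simpa using h)

end UpperBound

section LowerBound

variable {F : Type} [Field F] [Fintype F]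

theorem mem_charField_GL_two_of_pow_card_sub_one {c : ℂ} (hc : c ^ (Fintype.card F - 1) = 1) :
    c ∈ charField (GL (Fin 2) F) := by
  classical
  obtain ⟨u, hu⟩ := IsCyclic.exists_generator (α := Fˣ)
  have hcard : Fintype.card F - 1 ≠ 0 := Nat.sub_ne_zero_of_lt Fintype.one_lt_card
  obtain ⟨c, rfl⟩ : IsUnit c := IsUnit.of_pow_eq_one hc hcard
  have hdvd : orderOf c ∣ orderOf u := by
    rw [orderOf_eq_card_of_forall_mem_zpowers hu, Nat.card_units, Nat.card_eq_fintype_card]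
    exact orderOf_dvd_of_pow_eq_one (by ext1; simpa using hc)
  let χ : Fˣ →* ℂˣ := monoidHomOfForallMemZpowers hu hdvd
  let ρ : Representation ℂ (GL (Fin 2) F) ℂ :=
    (algebraMap ℂ (Module.End ℂ ℂ)).toMonoidHom.comp
      ((Units.coeHom ℂ).comp (χ.comp Matrix.GeneralLinearGroup.det))
  let g : GL (Fin 2) F :=
    Matrix.GeneralLinearGroup.mkOfDetNeZero (Matrix.diagonal ![u.1, 1]) (by simp)
  have hg : Matrix.GeneralLinearGroup.det g = u := by
    ext
    simp [g, Matrix.GeneralLinearGroup.mkOfDetNeZero]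
  have htrace : LinearMap.trace ℂ ℂ (ρ g) = c := by
    have : ρ g = (c : ℂ) • LinearMap.id := by
      simp only [ρ, MonoidHom.comp_apply, hg, χ, monoidHomOfForallMemZpowers_apply_gen]
      rfl
    rw [this, map_smul, LinearMap.trace_id]
    simp
  rw [← htrace]
  exact Representation.trace_mem_charField ρ g

/-- A generator of a non-split maximal torus. -/
theorem Matrix.GeneralLinearGroup.exists_torus_generator (p : ℕ) [Fact p.Prime] [CharP F p] :
    ∃ w : GL (Fin 2) F, w ^ (Fintype.card F ^ 2 - 1) = 1 ∧ IsConj w (w ^ Fintype.card F) ∧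
      ∀ j < Fintype.card F ^ 2 - 1, IsConj w (w ^ j) → j = 1 ∨ j = Fintype.card F := by
  let E := FiniteField.Extension F p 2
  let b : Module.Basis (Fin 2) F E :=
    Module.finBasisOfFinrankEq F E (FiniteField.finrank_extension F p 2)
  let φ := Algebra.leftMulMatrix b
  have hφ : Function.Injective φ := Algebra.leftMulMatrix_injective b
  have : Finite E := Module.finite_of_finite F
  obtain ⟨u, hu⟩ := IsCyclic.exists_generator (α := Eˣ)
  have horder : orderOf u = Fintype.card F ^ 2 - 1 := by
    rw [orderOf_eq_card_of_forall_mem_zpowers hu, Nat.card_units, FiniteField.natCard_extension,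
      Nat.card_eq_fintype_card]
  have hcard : 1 < Fintype.card F := Fintype.one_lt_card
  have hlt : Fintype.card F < Fintype.card F ^ 2 - 1 := by
    have : Fintype.card F * 2 ≤ Fintype.card F ^ 2 := by rw [sq]; gcongr; lia
    lia
  have hinj {i j : ℕ} (hi : i < Fintype.card F ^ 2 - 1) (hj : j < Fintype.card F ^ 2 - 1)
      (h : u.1 ^ i = u.1 ^ j) : i = j := by
    rw [← horder] at hi hj
    exact pow_injOn_Iio_orderOf hi hj (by ext1; simpa using h)
  have hne : u.1 ^ Fintype.card F ≠ u.1 := fun h ↦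
    hcard.ne' (hinj hlt (hcard.trans hlt) (by rw [h, pow_one]))
  let w : GL (Fin 2) F := Units.map φ.toMonoidHom u
  have hw (j : ℕ) : (w ^ j).1 = φ (u.1 ^ j) := by
    rw [map_pow]
    rfl
  have hwconj : IsConj w (w ^ Fintype.card F) := by
    refine (w.isConj_pow_card_or_sub_sq_eq_zero).elim And.right fun ⟨a, ha⟩ ↦ absurd ?_ hne
    have hua : (u.1 - algebraMap F E a) ^ 2 = 0 := by
      apply hφ
      rw [map_pow, map_sub, AlgHom.commutes, map_zero]
      exact ha
    rw [sub_eq_zero.1 (pow_eq_zero_iff two_ne_zero |>.1 hua), ← map_pow, FiniteField.pow_card]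
  have hquad {j : ℕ} (hj : IsConj w (w ^ j)) : (u.1 ^ j) ^ 2 -
      algebraMap F E w.1.trace * u.1 ^ j + algebraMap F E w.1.det = 0 := by
    obtain ⟨c, hc⟩ := isConj_iff.1 hj
    have h := Matrix.aeval_self_charpoly (w ^ j).1
    rw [Matrix.charpoly_fin_two, ← hc] at h
    simp only [Units.val_mul, Matrix.trace_units_conj, Matrix.det_units_conj] at h
    rw [← Units.val_mul, ← Units.val_mul, hc, hw] at h
    apply hφ
    simpa using h
  refine ⟨w, ?_, hwconj, fun j hj hwj ↦ ?_⟩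
  · rw [← map_pow, ← horder, pow_orderOf_eq_one, map_one]
  · have h1 := hquad (j := 1) (by rw [pow_one])
    have hq := hquad hwconj
    have hj' := hquad hwj
    rw [pow_one] at h1
    have htr : u.1 ^ Fintype.card F + u.1 - algebraMap F E w.1.trace = 0 := by
      refine (mul_eq_zero.1 ?_).resolve_left (sub_ne_zero.2 hne)
      linear_combination hq - h1
    have : (u.1 ^ j - u.1) * (u.1 ^ j - u.1 ^ Fintype.card F) = 0 := by
      linear_combination hj' - h1 - (u.1 ^ j - u.1) * htr
    rcases mul_eq_zero.1 this with h | h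
    · exact Or.inl (hinj hj (hcard.trans hlt) (by rw [sub_eq_zero.1 h, pow_one]))
    · exact Or.inr (hinj hj hlt (sub_eq_zero.1 h))

theorem add_pow_card_mem_charField_GL_two (p : ℕ) [Fact p.Prime] [CharP F p] {c : ℂ}
    (hc : c ^ (Fintype.card F ^ 2 - 1) = 1) :
    c + c ^ Fintype.card F ∈ charField (GL (Fin 2) F) := by
  obtain ⟨w, hw, hwq, hwj⟩ := Matrix.GeneralLinearGroup.exists_torus_generator (F := F) p
  have hcard : 1 < Fintype.card F := Fintype.one_lt_card
  have hlt : Fintype.card F < Fintype.card F ^ 2 - 1 := by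
    have : Fintype.card F * 2 ≤ Fintype.card F ^ 2 := by rw [sq]; gcongr; lia
    lia
  classical
  have h := sum_pow_mul_card_mem_charField hw hc w
  have hq : Nat.card {x : GL (Fin 2) F // w⁻¹ * x * w ^ Fintype.card F = x} =
      Nat.card {x : GL (Fin 2) F // w⁻¹ * x * w ^ 1 = x} := by
    obtain ⟨y, hy⟩ := isConj_iff.1 hwq
    refine Nat.card_congr ((Equiv.mulRight y).subtypeEquiv fun x ↦ ?_)
    rw [← hy, Equiv.coe_mulRight, pow_one, ← mul_assoc, ← mul_assoc, mul_inv_eq_iff_eq_mul,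
      mul_assoc w⁻¹ x y]
  have hsub : ({1, Fintype.card F} : Finset ℕ) ⊆ Finset.range (Fintype.card F ^ 2 - 1) := by
    intro j hj
    simp only [Finset.mem_insert, Finset.mem_singleton] at hj
    rw [Finset.mem_range]
    lia
  rw [← Finset.sum_subset hsub, Finset.sum_pair hcard.ne, hq, ← add_mul, pow_one] at h
  · have hne : (Nat.card {x : GL (Fin 2) F // w⁻¹ * x * w ^ 1 = x} : ℂ) ≠ 0 := by
      have : Nonempty {x : GL (Fin 2) F // w⁻¹ * x * w ^ 1 = x} := ⟨1, by simp⟩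
      exact Nat.cast_ne_zero.2 Nat.card_pos.ne'
    have := mul_mem h (inv_mem (natCast_mem (charField (GL (Fin 2) F))
      (Nat.card {x : GL (Fin 2) F // w⁻¹ * x * w ^ 1 = x})))
    rwa [mul_inv_cancel_right₀ hne] at this
  · intro j hj hj'
    have : IsEmpty {x : GL (Fin 2) F // w⁻¹ * x * w ^ j = x} := by
      refine ⟨fun ⟨x, hx⟩ ↦ hj' ?_⟩
      rw [Finset.mem_insert, Finset.mem_singleton]
      refine hwj j (Finset.mem_range.1 hj) (isConj_comm.1 (isConj_iff.2 ⟨x, ?_⟩))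
      rw [mul_inv_eq_iff_eq_mul]
      rwa [mul_assoc, inv_mul_eq_iff_eq_mul] at hx
    simp

end LowerBound

theorem zeta_isPrimitiveRoot {N : ℕ} (hN : N ≠ 0) : IsPrimitiveRoot (zeta N) N :=
  Complex.isPrimitiveRoot_exp N hN

theorem zeta_pow_eq_zeta {a b : ℕ} (hb : b ≠ 0) : zeta (a * b) ^ b = zeta a := by
  rw [zeta, zeta, ← Complex.exp_nat_mul]
  congr 1
  push_cast
  field_simp

/-- `K(GL_2(F_q)) = ℚ(ζ_{q−1}, {ζ_{q²−1}^r + ζ_{q²−1}^{qr} : 1 ≤ r ≤ (q²−1)/2})`. -/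
theorem statement12 (p n q : ℕ) (hp : p.Prime) (hn : 1 ≤ n) (hq : q = p ^ n)
    (F : Type) [Field F] [Fintype F] (hF : Fintype.card F = q) :
    charField (GL (Fin 2) F) =
      IntermediateField.adjoin ℚ
        ({zeta (q - 1)} ∪
          {x : ℂ | ∃ r : ℕ, 1 ≤ r ∧ r ≤ (q ^ 2 - 1) / 2 ∧
            x = zeta (q ^ 2 - 1) ^ r + zeta (q ^ 2 - 1) ^ (q * r)}) := by
  subst hF
  have : Fact p.Prime := ⟨hp⟩
  have : CharP F p := by
    obtain ⟨r, hr⟩ := CharP.exists F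
    obtain ⟨m, hr', hm⟩ := FiniteField.card F r
    rw [hm] at hq
    rwa [← (Nat.prime_dvd_prime_iff_eq hr' hp).1
      (hr'.dvd_of_dvd_pow (hq ▸ dvd_pow_self r m.pos.ne'))]
  set q := Fintype.card F
  have hq1 : 1 < q := Fintype.one_lt_card
  have hN : q ^ 2 - 1 = (q - 1) * (q + 1) := by
    rw [mul_comm, ← Nat.sq_sub_sq, one_pow]
  have hN0 : q ^ 2 - 1 ≠ 0 := by
    rw [hN]
    exact mul_ne_zero (by lia) (by lia)
  have hnorm : zeta (q ^ 2 - 1) * zeta (q ^ 2 - 1) ^ q = zeta (q - 1) := by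
    rw [← pow_succ', hN, zeta_pow_eq_zeta q.succ_ne_zero]
  apply le_antisymm
  · have hzeta : zeta (q - 1) ∈ IntermediateField.adjoin ℚ ({zeta (q - 1)} ∪
          {x : ℂ | ∃ r : ℕ, 1 ≤ r ∧ r ≤ (q ^ 2 - 1) / 2 ∧
            x = zeta (q ^ 2 - 1) ^ r + zeta (q ^ 2 - 1) ^ (q * r)}) :=
      IntermediateField.subset_adjoin _ _ (Or.inl rfl)
    refine charField_GL_two_le (p := p) _ (fun c hc ↦ ?_) (fun c hc ↦ ?_)
    · have : NeZero (q - 1) := ⟨by lia⟩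
      obtain ⟨i, -, rfl⟩ := (zeta_isPrimitiveRoot (NeZero.ne (q - 1))).eq_pow_of_pow_eq_one hc
      exact pow_mem hzeta i
    · have : NeZero (q ^ 2 - 1) := ⟨hN0⟩
      obtain ⟨r, hr, rfl⟩ := (zeta_isPrimitiveRoot hN0).eq_pow_of_pow_eq_one hc
      rw [← pow_mul, mul_comm r q]
      rcases Nat.eq_zero_or_pos r with rfl | hr0
      · simpa using add_mem (one_mem _) (one_mem _)
      by_cases hr2 : r ≤ (q ^ 2 - 1) / 2
      · exact IntermediateField.subset_adjoin _ _ (Or.inr ⟨r, hr0, hr2, rfl⟩)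
      obtain ⟨s, hs⟩ := Nat.exists_eq_add_of_le hr.le
      have hone : zeta (q ^ 2 - 1) ^ r * zeta (q ^ 2 - 1) ^ s = 1 := by
        rw [← pow_add, ← hs, (zeta_isPrimitiveRoot hN0).pow_eq_one]
      have hmem := mul_mem (pow_mem hzeta r)
        (IntermediateField.subset_adjoin ℚ _ (Or.inr ⟨s, by lia, by lia, rfl⟩))
      convert hmem using 1
      rw [← hnorm, mul_comm q r, mul_comm q s, pow_mul, pow_mul, mul_pow, pow_right_comm _ q r]
      generalize zeta (q ^ 2 - 1) ^ r = x at *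
      generalize zeta (q ^ 2 - 1) ^ s = y at *
      have honeq : x ^ q * y ^ q = 1 := by rw [← mul_pow, hone, one_pow]
      linear_combination (-x ^ q) * hone - x * honeq
  · have hzeta : zeta (q - 1) ∈ charField (GL (Fin 2) F) :=
      mem_charField_GL_two_of_pow_card_sub_one (zeta_isPrimitiveRoot (by lia)).pow_eq_one
    rw [IntermediateField.adjoin_le_iff]
    rintro _ (rfl | ⟨r, -, -, rfl⟩)
    · exact hzeta
    · rw [mul_comm q r, pow_mul]
      refine add_pow_card_mem_charField_GL_two (F := F) p ?_
      rw [pow_right_comm, (zeta_isPrimitiveRoot hN0).pow_eq_one, one_pow]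
end

section
/- Let p be a prime and q = p^n, and let d ∈ {3, 4, 6} with q ≡ −1 (mod d). Then K_d(GL_2(F_q)) = ℚ. -/
open CategoryTheory

theorem LinearMap.trace_geom_sum_mem_bot {V : Type*} [AddCommGroup V] [Module ℂ V]
    [FiniteDimensional ℂ V] (B : Module.End ℂ V) {m : ℕ} (hm : m ≠ 0) (hB : B ^ m = 1) :
    LinearMap.trace ℂ V (∑ i ∈ Finset.range m, B ^ i) ∈ (⊥ : IntermediateField ℚ ℂ) := by
  set P : Module.End ℂ V := ∑ i ∈ Finset.range m, B ^ i with hP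
  have hBP : B * P = P := by
    have h := mul_geom_sum B m
    rw [hB, sub_self, sub_mul, one_mul] at h
    exact sub_eq_zero.mp h
  have hpow (i : ℕ) : B ^ i * P = P := by
    induction i with
    | zero => simp
    | succ i ih => rw [pow_succ, mul_assoc, hBP, ih]
  have hPP : P * P = (m : ℂ) • P := by
    conv_lhs => enter [1]; rw [hP]
    rw [Finset.sum_mul, Finset.sum_congr rfl fun i _ => hpow i]
    simp [Nat.cast_smul_eq_nsmul]
  have hm' : (m : ℂ) ≠ 0 := Nat.cast_ne_zero.mpr hm
  have hidem : IsIdempotentElem ((m : ℂ)⁻¹ • P) := by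
    rw [IsIdempotentElem, smul_mul_smul_comm, hPP, smul_smul]
    congr 1
    field_simp
  have htr := (LinearMap.isProj_range_iff_isIdempotentElem _ |>.mpr hidem).trace
  rw [map_smul, smul_eq_mul, inv_mul_eq_iff_eq_mul₀ hm'] at htr
  rw [htr]
  exact mul_mem (natCast_mem _ _) (natCast_mem _ _)

theorem LinearMap.trace_add_trace_pow_pred_mem_bot {V : Type*} [AddCommGroup V] [Module ℂ V]
    [FiniteDimensional ℂ V] (A : Module.End ℂ V) {d : ℕ} (hd : d ∈ ({3, 4, 6} : Set ℕ))
    (hA : A ^ d = 1) :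
    LinearMap.trace ℂ V A + LinearMap.trace ℂ V (A ^ (d - 1)) ∈
      (⊥ : IntermediateField ℚ ℂ) := by
  have hone : LinearMap.trace ℂ V 1 ∈ (⊥ : IntermediateField ℚ ℂ) := by
    rw [LinearMap.trace_one]
    exact natCast_mem _ _
  have hsum := LinearMap.trace_geom_sum_mem_bot A
    (by rintro rfl; simp at hd : d ≠ 0) hA
  rw [← map_add]
  rcases hd with rfl | rfl | rfl
  · convert sub_mem hsum hone using 1
    rw [← map_sub]
    congr 1
    simp only [Finset.sum_range_succ, Finset.sum_range_zero]
    noncomm_ring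
  · have h2 := LinearMap.trace_geom_sum_mem_bot (A ^ 2) two_ne_zero (by rw [← pow_mul, hA])
    convert sub_mem hsum h2 using 1
    rw [← map_sub]
    congr 1
    simp only [Finset.sum_range_succ, Finset.sum_range_zero]
    noncomm_ring
  · have h2 := LinearMap.trace_geom_sum_mem_bot (A ^ 2) three_ne_zero (by rw [← pow_mul, hA])
    have h3 := LinearMap.trace_geom_sum_mem_bot (A ^ 3) two_ne_zero (by rw [← pow_mul, hA])
    convert add_mem (sub_mem (sub_mem hsum h2) h3) hone using 1
    rw [← map_sub, ← map_sub, ← map_add]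
    congr 1
    simp only [Finset.sum_range_succ, Finset.sum_range_zero]
    noncomm_ring

theorem FDRep.character_mem_bot_of_isConj_inv {G : Type} [Group G] (V : FDRep ℂ G) {g : G}
    (hd : orderOf g ∈ ({3, 4, 6} : Set ℕ)) (hg : IsConj g g⁻¹) :
    V.character g ∈ (⊥ : IntermediateField ℚ ℂ) := by
  have hinv : V.character g⁻¹ = V.character g := by
    obtain ⟨h, hh⟩ := isConj_iff.mp hg
    rw [← hh, FDRep.char_conj]
  have hpow : g⁻¹ = g ^ (orderOf g - 1) := by
    have hpos : orderOf g ≠ 0 := by intro h; simp [h] at hd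
    rw [inv_eq_iff_mul_eq_one, ← pow_succ', Nat.sub_add_cancel (Nat.one_le_iff_ne_zero.mpr hpos),
      pow_orderOf_eq_one]
  have h := LinearMap.trace_add_trace_pow_pred_mem_bot (V.ρ g) hd
    (by rw [← map_pow, pow_orderOf_eq_one, map_one])
  rw [← map_pow, ← hpow] at h
  change V.character g + V.character g⁻¹ ∈ _ at h
  rw [hinv, ← two_mul] at h
  have h2 := mul_mem (inv_mem (natCast_mem (⊥ : IntermediateField ℚ ℂ) 2)) h
  simpa using h2

theorem Matrix.unitriangular_pow {R : Type*} [CommRing R] (b : R) (k : ℕ) :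
    !![1, b; 0, 1] ^ k = !![1, k * b; 0, 1] := by
  induction k with
  | zero => simp [Matrix.one_fin_two]
  | succ k ih =>
    rw [pow_succ, ih, Matrix.mul_fin_two]
    congr! 3 <;> (simp; try ring)

section FiniteField

variable {F : Type*} [Field F] [Fintype F] {d : ℕ}

theorem FiniteField.sq_eq_one_of_pow_eq_one (hd : d ∣ Fintype.card F + 1) {x : F}
    (hx : x ^ d = 1) : x ^ 2 = 1 := by
  obtain ⟨k, hk⟩ := hd
  have h : x ^ (Fintype.card F + 1) = 1 := by rw [hk, pow_mul, hx, one_pow]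
  rwa [pow_succ, FiniteField.pow_card, ← sq] at h

theorem FiniteField.natCast_ne_zero_of_dvd_card_add_one (hd : d ∣ Fintype.card F + 1) :
    (d : F) ≠ 0 := by
  obtain ⟨k, hk⟩ := hd
  intro h
  have := congrArg (Nat.cast : ℕ → F) hk
  simp [h] at this

theorem Matrix.sq_eq_one_of_upperTriangular (hd : d ∣ Fintype.card F + 1) (a b e : F)
    (h : !![a, b; 0, e] ^ d = 1) : !![a, b; 0, e] ^ 2 = 1 := by
  have hdiag (k : ℕ) : ∃ x, !![a, b; 0, e] ^ k = !![a ^ k, x; 0, e ^ k] := by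
    induction k with
    | zero => exact ⟨0, by simp [Matrix.one_fin_two]⟩
    | succ k ih =>
      obtain ⟨x, hx⟩ := ih
      exact ⟨a ^ k * b + x * e, by rw [pow_succ, hx, Matrix.mul_fin_two]; simp [pow_succ]⟩
  obtain ⟨x, hx⟩ := hdiag d
  rw [h] at hx
  have ha : a ^ d = 1 := by simpa using (congrFun₂ hx 0 0).symm
  have he : e ^ d = 1 := by simpa using (congrFun₂ hx 1 1).symm
  obtain ⟨y, hy⟩ := hdiag 2
  rw [FiniteField.sq_eq_one_of_pow_eq_one hd ha, FiniteField.sq_eq_one_of_pow_eq_one hd he] at hy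
  have h2 : (!![a, b; 0, e] ^ 2) ^ d = 1 := by rw [← pow_mul, mul_comm, pow_mul, h, one_pow]
  rw [hy, Matrix.unitriangular_pow] at h2
  have hy0 : (d : F) * y = 0 := by simpa using congrFun₂ h2 0 1
  rw [hy, (mul_eq_zero.mp hy0).resolve_left
    (FiniteField.natCast_ne_zero_of_dvd_card_add_one hd), Matrix.one_fin_two]

theorem Matrix.det_fin_two_eq_one_of_pow_eq_one (hd : d ∈ ({3, 4, 6} : Set ℕ))
    (hdvd : d ∣ Fintype.card F + 1) {a b c e : F} (hc : c ≠ 0)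
    (h : !![a, b; c, e] ^ d = 1) (h2 : !![a, b; c, e] ^ 2 ≠ 1) : a * e - b * c = 1 := by
  set M : Matrix (Fin 2) (Fin 2) F := !![a, b; c, e] with hM
  have hdet : (a * e - b * c) ^ d = 1 := by
    rw [← Matrix.det_fin_two_of, ← Matrix.det_pow, ← hM, h, Matrix.det_one]
  have hdet2 := FiniteField.sq_eq_one_of_pow_eq_one hdvd hdet
  by_contra hdet1
  have hneg : a * e - b * c = -1 := (sq_eq_sq_iff_eq_or_eq_neg.mp (hdet2.trans (one_pow 2).symm)).resolve_left hdet1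
  set t := a + e with ht
  have hne := FiniteField.natCast_ne_zero_of_dvd_card_add_one hdvd
  have hsq : M ^ 2 = t • M + (1 : F) • 1 := by
    rw [hM, sq, Matrix.mul_fin_two, Matrix.one_fin_two]
    ext i j
    fin_cases i <;> fin_cases j <;> simp [ht] <;> grind
  have hscalar (u v : F) (huv : u • M + v • (1 : Matrix (Fin 2) (Fin 2) F) = 1) :
      u = 0 ∧ v = 1 := by
    have hu : u = 0 := by simpa [hM, hc] using congrFun₂ huv 1 0
    refine ⟨hu, ?_⟩
    simpa [hu] using congrFun₂ huv 0 0
  have ht0 : t ≠ 0 := by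
    intro h0
    rw [h0] at hsq
    exact h2 (by simpa using hsq)
  have hmul (u v u' v' : F) : (u • M + v • (1 : Matrix (Fin 2) (Fin 2) F)) * (u' • M + v' • 1) =
      (u * u' * t + u * v' + v * u') • M + (u * u' + v * v') • 1 := by
    have : (u • M + v • (1 : Matrix (Fin 2) (Fin 2) F)) * (u' • M + v' • 1) =
        (u * u') • M ^ 2 + (u * v' + v * u') • M + (v * v') • 1 := by
      simp only [add_mul, mul_add, smul_mul_smul_comm, mul_one, one_mul, sq]
      module
    rw [this, hsq]
    module
  rcases hd with rfl | rfl | rfl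
  · exact hdet1 (by rw [← hdet, pow_succ, hdet2, one_mul])
  · rw [show 4 = 2 * 2 from rfl, pow_mul, sq (M ^ 2), hsq, hmul] at h
    obtain ⟨-, hv⟩ := hscalar _ _ h
    exact ht0 (by simpa using hv)
  · rw [show 6 = 2 * 3 from rfl, pow_mul, pow_succ, sq (M ^ 2), hsq, hmul, hmul] at h
    obtain ⟨-, hv⟩ := hscalar _ _ h
    have ht3 : t ^ 2 = -3 := by
      have : t ^ 2 * (t ^ 2 + 3) = 0 := by linear_combination hv
      have := (mul_eq_zero.mp this).resolve_left (pow_ne_zero 2 ht0)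
      linear_combination this
    have h12 : (2 : F) ≠ 0 ∧ (3 : F) ≠ 0 := by
      rw [← not_or, ← mul_eq_zero]
      norm_num at hne ⊢
      exact hne
    have hx3 : ((t - 1) / 2) ^ 3 = 1 := by
      have := h12.1
      field_simp
      linear_combination (t - 3) * ht3
    have hx2 := FiniteField.sq_eq_one_of_pow_eq_one hdvd
      (show ((t - 1) / 2) ^ 6 = 1 by rw [show 6 = 3 * 2 from rfl, pow_mul, hx3, one_pow])
    rw [pow_succ, hx2, one_mul, div_eq_one_iff_eq h12.1] at hx3
    have : (2 : F) * 2 * 3 = 0 := by linear_combination ht3 - (t + 3) * hx3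
    simp [h12] at this

end FiniteField

theorem Matrix.GeneralLinearGroup.isConj_inv_of_det_eq_one {K : Type*} [Field K]
    (g : GL (Fin 2) K) (hc : g 1 0 ≠ 0) (hdet : g.val.det = 1) : IsConj g g⁻¹ := by
  let h : GL (Fin 2) K := Matrix.GeneralLinearGroup.mkOfDetNeZero
    !![g 1 0, g 1 1 - g 0 0; 0, - g 1 0] (by simpa [Matrix.det_fin_two_of] using hc)
  rw [isConj_iff]
  refine ⟨h, ?_⟩
  rw [mul_inv_eq_iff_eq_mul, eq_inv_mul_iff_mul_eq]
  rw [Matrix.det_fin_two] at hdet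
  ext i j
  fin_cases i <;> fin_cases j <;>
    simp [h, Matrix.mul_apply, Matrix.vecMul, dotProduct, Fin.sum_univ_two,
      Matrix.GeneralLinearGroup.mkOfDetNeZero] <;> grind

theorem Matrix.GeneralLinearGroup.isConj_inv_of_orderOf {F : Type*} [Field F] [Fintype F]
    {g : GL (Fin 2) F} (hd : orderOf g ∈ ({3, 4, 6} : Set ℕ))
    (hdvd : orderOf g ∣ Fintype.card F + 1) : IsConj g g⁻¹ := by
  have hM : g.val = !![g 0 0, g 0 1; g 1 0, g 1 1] := Matrix.eta_fin_two _
  have hpow : g.val ^ orderOf g = 1 := by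
    rw [← Units.val_pow_eq_pow_val, pow_orderOf_eq_one, Units.val_one]
  have hsq : g.val ^ 2 ≠ 1 := by
    intro h
    have h2 : g ^ 2 = 1 := Units.ext (by rw [Units.val_pow_eq_pow_val, h, Units.val_one])
    have := Nat.le_of_dvd two_pos (orderOf_dvd_of_pow_eq_one h2)
    simp only [Set.mem_insert_iff, Set.mem_singleton_iff] at hd
    omega
  have hc : g 1 0 ≠ 0 := by
    intro h0
    rw [hM, h0] at hpow hsq
    exact hsq (Matrix.sq_eq_one_of_upperTriangular hdvd _ _ _ hpow)
  refine isConj_inv_of_det_eq_one g hc ?_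
  rw [Matrix.det_fin_two]
  rw [hM] at hpow hsq
  exact Matrix.det_fin_two_eq_one_of_pow_eq_one hd hdvd hc hpow hsq

/-- For `d ∈ {3, 4, 6}` with `q ≡ −1 (mod d)`, `K_d(GL_2(F_q)) = ℚ`. -/
theorem statement14 (p n q d : ℕ) (hp : p.Prime) (hn : 1 ≤ n) (hq : q = p ^ n)
    (hd : d ∈ ({3, 4, 6} : Set ℕ)) (hcong : (q : ZMod d) = -1)
    (F : Type) [Field F] [Fintype F] (hF : Fintype.card F = q) :
    charFieldAt (GL (Fin 2) F) d = ⊥ := by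
  have hdvd : d ∣ Fintype.card F + 1 := by
    rw [hF, ← ZMod.natCast_eq_zero_iff]
    simp [hcong]
  rw [charFieldAt, eq_bot_iff, IntermediateField.adjoin_le_iff]
  rintro x ⟨V, -, g, rfl, rfl⟩
  exact V.character_mem_bot_of_isConj_inv hd
    (Matrix.GeneralLinearGroup.isConj_inv_of_orderOf hd hdvd)
end

section
/- Let p be a prime and q = p^n with q ≡ −1 (mod 5). Then K_5(GL_2(F_q)) = ℚ(√5). -/
open CategoryTheory

open Polynomial in
theorem spectral_idempotent {V : Type*} [AddCommGroup V] [Module ℂ V]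
    (T : Module.End ℂ V) (hT : T ^ 5 = 1) (c d : ℂ) (hs : c + d = -1) (hp : c * d = -1) :
    IsIdempotentElem ((1 / 5 : ℂ) • ((2 : ℂ) • 1 + c • (T + T ^ 4) + d • (T ^ 2 + T ^ 3))) := by
  have hs' : (C c + C d : ℂ[X]) = -1 := by rw [← C_add, hs, C_neg, C_1]
  have hp' : (C c * C d : ℂ[X]) = -1 := by rw [← C_mul, hp, C_neg, C_1]
  have h5 : (5 * C (1/5) : ℂ[X]) = 1 := by
    rw [show (5 : ℂ[X]) = C 5 from rfl, ← C_mul, ← C_1]; norm_num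
  set Q : ℂ[X] := C (1/5) * (C 2 + C c * (X + X ^ 4) + C d * (X ^ 2 + X ^ 3)) with hQ
  have key : Q * Q = Q + (X ^ 5 - 1) * (C (1/5) ^ 2 * (C c ^ 2 * (X ^ 3 + 2) +
      2 * C c * C d * (X + X ^ 2) + C d ^ 2 * (2 + X))) := by
    have h2 : (C 2 : ℂ[X]) = 2 := rfl
    rw [hQ, h2]
    generalize (C (1/5) : ℂ[X]) = u at *
    have hc : C c = -1 - C d := by linear_combination hs'
    rw [hc] at hp' ⊢
    generalize C d = y at *
    have hy : y ^ 2 = 1 - y := by linear_combination -hp'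
    have hu : u = 5 * u ^ 2 := by linear_combination -u * h5
    grind
  have := congrArg (aeval T) key
  simp only [map_mul, map_add, map_sub, map_pow, aeval_X, hT, map_one, sub_self, zero_mul,
    add_zero] at this
  have e : aeval T Q = (1 / 5 : ℂ) • ((2 : ℂ) • 1 + c • (T + T ^ 4) + d • (T ^ 2 + T ^ 3)) := by
    simp [hQ, aeval_C, Algebra.smul_def]
  rw [← e]; exact this

theorem exists_trace_eq_add_mul_sqrt_five {V : Type*} [AddCommGroup V] [Module ℂ V]
    [FiniteDimensional ℂ V] (T : Module.End ℂ V) (hT : T ^ 5 = 1)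
    (h1 : LinearMap.trace ℂ V (T ^ 4) = LinearMap.trace ℂ V T)
    (h2 : LinearMap.trace ℂ V (T ^ 3) = LinearMap.trace ℂ V (T ^ 2)) :
    ∃ a b : ℚ, LinearMap.trace ℂ V T = a + b * (Real.sqrt 5 : ℂ) ∧
      LinearMap.trace ℂ V (T ^ 2) = a - b * (Real.sqrt 5 : ℂ) := by
  have hr : ((Real.sqrt 5 : ℝ) : ℂ) ^ 2 = 5 := by
    rw [← Complex.ofReal_pow, Real.sq_sqrt (by norm_num)]; norm_num
  set r : ℂ := ((Real.sqrt 5 : ℝ) : ℂ)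
  have hQ := (LinearMap.IsIdempotentElem.isProj_range _ (spectral_idempotent T hT
    ((-1 + r) / 2) ((-1 - r) / 2) (by ring) (by linear_combination -hr / 4))).trace
  have hQ' := (LinearMap.IsIdempotentElem.isProj_range _ (spectral_idempotent T hT
    ((-1 - r) / 2) ((-1 + r) / 2) (by ring) (by linear_combination -hr / 4))).trace
  simp only [map_smul, map_add, h1, h2, LinearMap.trace_one, smul_eq_mul] at hQ hQ'
  generalize (Module.finrank ℂ (LinearMap.range (_ : Module.End ℂ V))) = m at hQ
  generalize (Module.finrank ℂ (LinearMap.range (_ : Module.End ℂ V))) = m' at hQ'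
  generalize Module.finrank ℂ V = n at *
  generalize LinearMap.trace ℂ V T = tr at *
  generalize LinearMap.trace ℂ V (T ^ 2) = tr2 at *
  refine ⟨(4 * n - 5 * m - 5 * m') / 4, (m - m') / 4, ?_, ?_⟩
  all_goals push_cast
  · linear_combination -5 / 4 * (hQ + hQ') + 1 / 4 * r * (hQ - hQ') - (tr - tr2) / 10 * hr
  · linear_combination -5 / 4 * (hQ + hQ') - 1 / 4 * r * (hQ - hQ') + (tr - tr2) / 10 * hr

theorem sum_conj_eq_of_character_eq {G V : Type*} [Group G] [Fintype G]
    [AddCommGroup V] [Module ℂ V] [FiniteDimensional ℂ V] (ρ : Representation ℂ G V)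
    [ρ.IsIrreducible] (g g' : G) (h : ρ.character g = ρ.character g') :
    ∑ x, ρ (x * g * x⁻¹) = ∑ x, ρ (x * g' * x⁻¹) := by
  set T : V →ₗ[ℂ] V := ∑ x, ρ (x * g * x⁻¹) - ∑ x, ρ (x * g' * x⁻¹) with hT
  have comm (k y : G) : ρ y * ∑ x, ρ (x * k * x⁻¹) = (∑ x, ρ (x * k * x⁻¹)) * ρ y := by
    rw [Finset.mul_sum, Finset.sum_mul]
    refine Fintype.sum_equiv (Equiv.mulLeft y) _ _ fun x => ?_
    rw [← map_mul, ← map_mul]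
    congr 1
    simp [mul_assoc]
  let f : Representation.IntertwiningMap ρ ρ := ⟨T, fun y => by
    change T * ρ y = ρ y * T
    rw [hT, mul_sub, sub_mul, comm, comm]⟩
  obtain ⟨c, hc⟩ :=
    (Representation.IsIrreducible.algebraMap_intertwiningMap_bijective_of_isAlgClosed
      (ρ := ρ)).2 f
  have hTc : T = c • 1 := by
    have := congrArg Representation.IntertwiningMap.toLinearMap hc
    rw [← show f.toLinearMap = T from rfl, ← this, Algebra.algebraMap_eq_smul_one]
    rfl
  have htr : LinearMap.trace ℂ V T = 0 := by
    have e (k : G) : LinearMap.trace ℂ V (∑ x, ρ (x * k * x⁻¹)) =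
        Fintype.card G * ρ.character k := by
      rw [map_sum]
      change ∑ x, ρ.character (x * k * x⁻¹) = _
      simp
    rw [hT, map_sub, e, e, h, sub_self]
  rw [hTc, map_smul, LinearMap.trace_one, smul_eq_mul, mul_eq_zero, Nat.cast_eq_zero] at htr
  rw [← sub_eq_zero, ← hT, hTc]
  rcases htr with rfl | h0
  · simp
  · have := Module.finrank_zero_iff.1 h0
    exact Subsingleton.elim _ _

theorem simple_of_isIrreducible {G V : Type} [Group G] [Fintype G] [AddCommGroup V]
    [Module ℂ V] [FiniteDimensional ℂ V] (ρ : Representation ℂ G V) [ρ.IsIrreducible] :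
    Simple (FDRep.of ρ) := by
  rw [FDRep.simple_iff_char_is_norm_one]
  have := invertibleOfNonzero (NeZero.ne (Nat.card G : ℂ))
  have h := Representation.char_orthonormal ρ ρ
  rw [if_pos ⟨.refl ρ⟩, inv_mul_eq_one₀ (NeZero.ne _)] at h
  exact h.symm

theorem ofModule'_asAlgebraHom_apply {k G M : Type*} [Field k] [Monoid G] [AddCommGroup M]
    [Module k M] [Module (MonoidAlgebra k G) M] [IsScalarTower k (MonoidAlgebra k G) M]
    (a : MonoidAlgebra k G) (m : M) :
    (Representation.ofModule' (k := k) (G := G) M).asAlgebraHom a m = a • m := by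
  simp [Representation.ofModule', Representation.asAlgebraHom]

theorem isIrreducible_ofModule' {k G M : Type*} [Field k] [Monoid G] [AddCommGroup M]
    [Module k M] [Module (MonoidAlgebra k G) M] [IsScalarTower k (MonoidAlgebra k G) M]
    [IsSimpleModule (MonoidAlgebra k G) M] :
    (Representation.ofModule' (k := k) (G := G) M).IsIrreducible := by
  rw [Representation.irreducible_iff_isSimpleModule_asModule]
  let e : (Representation.ofModule' (k := k) (G := G) M).asModule ≃ₗ[MonoidAlgebra k G] M :=
    { (Representation.ofModule' (k := k) (G := G) M).asModuleEquiv with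
      map_smul' := fun a m => by
        change Representation.asModuleEquiv _ (a • m) = _
        rw [Representation.asModuleEquiv_map_smul, ofModule'_asAlgebraHom_apply]
        rfl }
  exact IsSimpleModule.congr e

theorem sum_conj_smul_eq_of_forall_character_eq {G M : Type} [Group G] [Fintype G]
    [AddCommGroup M] [Module ℂ M] [Module (MonoidAlgebra ℂ G) M]
    [IsScalarTower ℂ (MonoidAlgebra ℂ G) M] [FiniteDimensional ℂ M]
    [IsSimpleModule (MonoidAlgebra ℂ G) M] (g g' : G)
    (h : ∀ V : FDRep ℂ G, Simple V → V.character g = V.character g') (m : M) :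
    (∑ x, MonoidAlgebra.of ℂ G (x * g * x⁻¹)) • m =
      (∑ x, MonoidAlgebra.of ℂ G (x * g' * x⁻¹)) • m := by
  let σ := Representation.ofModule' (k := ℂ) (G := G) M
  have : σ.IsIrreducible := isIrreducible_ofModule'
  have hsum := sum_conj_eq_of_character_eq σ g g' (h _ (simple_of_isIrreducible σ))
  have asAlgebraHom_sum (k : G) : ∑ x, σ (x * k * x⁻¹) =
      σ.asAlgebraHom (∑ x, MonoidAlgebra.of ℂ G (x * k * x⁻¹)) := by
    simp
  rw [asAlgebraHom_sum, asAlgebraHom_sum] at hsum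
  rw [← ofModule'_asAlgebraHom_apply, ← ofModule'_asAlgebraHom_apply]
  exact LinearMap.congr_fun hsum m

theorem exists_conj_eq_of_forall_character_eq {G : Type} [Group G] [Fintype G] (g g' : G)
    (h : ∀ V : FDRep ℂ G, Simple V → V.character g = V.character g') :
    ∃ x, x * g' * x⁻¹ = g := by
  classical
  by_contra! hne
  let z (k : G) : (MonoidAlgebra ℂ G) := ∑ x : G, MonoidAlgebra.of ℂ G (x * k * x⁻¹)
  have hz (S : Submodule (MonoidAlgebra ℂ G) (MonoidAlgebra ℂ G))
      (hS : IsSimpleModule (MonoidAlgebra ℂ G) S) (s : MonoidAlgebra ℂ G) (hs : s ∈ S) :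
      z g * s = z g' * s :=
    congrArg Subtype.val (sum_conj_smul_eq_of_forall_character_eq g g' h (⟨s, hs⟩ : S))
  have comm (k : G) (a : (MonoidAlgebra ℂ G)) : z k * a = a * z k := by
    induction a using MonoidAlgebra.induction_on with
    | of y =>
      simp only [z]
      rw [Finset.mul_sum, Finset.sum_mul]
      symm
      refine Fintype.sum_equiv (Equiv.mulLeft y) _ _ fun x => ?_
      rw [← map_mul, ← map_mul]
      congr 1
      simp [mul_assoc]
    | add a b ha hb => rw [mul_add, add_mul, ha, hb]
    | smul c a ha => rw [mul_smul_comm, smul_mul_assoc, ha]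
  have hk : LinearMap.ker (LinearMap.toSpanSingleton (MonoidAlgebra ℂ G) _ (z g - z g')) = ⊤ := by
    rw [eq_top_iff,
      ← IsSemisimpleModule.sSup_simples_eq_top (MonoidAlgebra ℂ G) (MonoidAlgebra ℂ G)]
    refine sSup_le fun S hS s hs => ?_
    have := hz S hS s hs
    rw [LinearMap.mem_ker, LinearMap.toSpanSingleton_apply, smul_eq_mul, mul_sub,
      ← comm, ← comm, this, sub_self]
  have h0 : z g = z g' := by
    have : (1 : MonoidAlgebra ℂ G) ∈
        LinearMap.ker (LinearMap.toSpanSingleton (MonoidAlgebra ℂ G) _ (z g - z g')) :=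
      hk ▸ trivial
    simpa [sub_eq_zero] using this
  have coeff (k : G) : (z k).coeff g = (Finset.univ.filter fun x => x * k * x⁻¹ = g).card := by
    simp [z, MonoidAlgebra.of_apply, Finsupp.single_apply]
  have h1 := coeff g
  rw [h0, coeff g', Nat.cast_inj] at h1
  rw [Finset.filter_false_of_mem (fun x _ => hne x)] at h1
  have : (1 : G) ∈ Finset.univ.filter fun x => x * g * x⁻¹ = g := by simp
  rw [Finset.card_eq_zero.1 h1.symm] at this
  simp at this

theorem conj_inv_and_not_conj_sq_of_orderOf_eq_five {F : Type} [Field F] (h5 : (5:F) ≠ 0)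
   (hq : ∀ x : F, x ^ 5 = 1 → x = 1) (g : GL (Fin 2) F) (hg : orderOf g = 5) :
   (∃ h : GL (Fin 2) F, h * g * h⁻¹ = g⁻¹) ∧ ∀ h : GL (Fin 2) F, h * g ^ 2 * h⁻¹ ≠ g := by
  have hg5 : g ^ 5 = 1 := hg ▸ pow_orderOf_eq_one g
  have hg1 : g ≠ 1 := by rintro rfl; simp at hg
  have hdet : g.val.det = 1 := by
    apply hq
    rw [← Matrix.det_pow, ← Units.val_pow_eq_pow_val, hg5]; simp
  have hM5 : g.1 ^ 5 = 1 := by rw [← Units.val_pow_eq_pow_val, hg5]; simp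
  have hM1 : g.1 ≠ 1 := fun h => hg1 (Units.ext h)
  have hinv : (g⁻¹).1 = g.val.adjugate := by
    have : g.1 * g.val.adjugate = 1 := by rw [Matrix.mul_adjugate, hdet, one_smul]
    exact (left_inv_eq_right_inv g.inv_mul this)
  refine ⟨?_, ?_⟩
  · obtain ⟨a, b, c, d, hM⟩ : ∃ a b c d, g.1 = !![a, b; c, d] :=
      ⟨_, _, _, _, Matrix.eta_fin_two _⟩
    have hc : c ≠ 0 := by
      rintro rfl
      rw [hM, Matrix.det_fin_two_of] at hdet
      have key : g.1 ^ 5 = !![a ^ 5, b * (a^4 + a^3*d+a^2*d^2+a*d^3+d^4); 0, d ^ 5] := by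
        rw [hM]
        ext i j
        fin_cases i <;> fin_cases j <;> simp [pow_succ, Matrix.mul_apply, Fin.sum_univ_two] <;> ring
      rw [hM5] at key
      have ha := hq a (by simpa using (congrFun (congrFun key 0) 0).symm)
      have hd := hq d (by simpa using (congrFun (congrFun key 1) 1).symm)
      have hb := (congrFun (congrFun key 0) 1).symm
      subst ha hd
      have : b * 5 = 0 := by simp at hb; grind
      have hb : b = 0 := by simpa [h5] using this
      exact hM1 (by rw [hM, hb, Matrix.one_fin_two])
    let h := Matrix.GeneralLinearGroup.mkOfDetNeZero !![c, d - a; 0, -c] (by simp [hc])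
    refine ⟨h, ?_⟩
    rw [mul_inv_eq_iff_eq_mul]
    apply Units.ext
    rw [Units.val_mul, Units.val_mul, hinv, hM, Matrix.adjugate_fin_two_of]
    change !![c, d - a; 0, -c] * _ = _ * !![c, d - a; 0, -c]
    simp
    grind
  · intro h hh
    have htr : (g.1 ^ 2).trace = g.val.trace := by
      conv_rhs => rw [← hh]
      rw [Units.val_mul, Matrix.trace_mul_comm, ← Units.val_mul, ← mul_assoc, inv_mul_cancel,
        one_mul, Units.val_pow_eq_pow_val]
    obtain ⟨a, b, c, d, hM⟩ : ∃ a b c d, g.1 = !![a, b; c, d] :=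
      ⟨_, _, _, _, Matrix.eta_fin_two _⟩
    have hCH : g.1 ^ 2 = g.val.trace • g.1 - 1 := by
      rw [hM, Matrix.det_fin_two_of] at hdet
      rw [hM, Matrix.trace_fin_two_of, pow_two, Matrix.mul_fin_two, Matrix.one_fin_two]
      ext i j
      fin_cases i <;> fin_cases j <;> simp <;> grind
    have ht : (g.val.trace - 2) * (g.val.trace + 1) = 0 := by
      have := congrArg Matrix.trace hCH
      rw [htr] at this
      simp only [Matrix.trace_sub, Matrix.trace_smul, Matrix.trace_one, Fintype.card_fin,
        smul_eq_mul, Nat.cast_ofNat] at this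
      linear_combination -this
    generalize g.val.trace = t at *
    generalize hgM : g.1 = M at *
    have h3 : M ^ 3 = (t ^ 2 - 1) • M - t • 1 := by
      rw [pow_succ, hCH, sub_mul, smul_mul_assoc, ← pow_two, hCH, one_mul]
      module
    rcases mul_eq_zero.1 ht with h | h
    · obtain rfl : t = 2 := by linear_combination h
      have : (5 : F) • (M - 1) = 0 := by
        have e : M ^ 5 = M ^ 3 * M ^ 2 := by rw [← pow_add]
        rw [h3, hCH, hM5, sub_mul, mul_sub, smul_mul_smul_comm, ← pow_two, hCH] at e
        simp only [smul_mul_assoc, one_mul, mul_one] at e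
        have e' := sub_eq_zero.2 e.symm
        rw [← e']
        module
      exact hM1 (sub_eq_zero.1 ((smul_eq_zero.1 this).resolve_left h5))
    · obtain rfl : t = -1 := by linear_combination h
      have h3 : g ^ 3 = 1 := by
        apply Units.ext
        rw [Units.val_pow_eq_pow_val, hgM, h3]
        simp
      have := orderOf_dvd_of_pow_eq_one h3
      rw [hg] at this; norm_num at this

theorem five_ne_zero_of_card_mod_five (F : Type*) [Field F] [Fintype F]
    (h : Fintype.card F % 5 = 4) : (5 : F) ≠ 0 := by
  intro h0
  have : ringChar F ∣ 5 := ringChar.dvd (by exact_mod_cast h0)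
  obtain h1 | h1 := (Nat.dvd_prime Nat.prime_five).1 this
  · exact CharP.ringChar_ne_one h1
  · obtain ⟨n, -, hn⟩ := FiniteField.card F (ringChar F)
    rw [hn, h1] at h
    have := dvd_pow_self 5 n.ne_zero
    omega

theorem eq_one_of_pow_five_eq_one (F : Type*) [Field F] [Fintype F]
    (h : Fintype.card F % 5 = 4) (x : F) (hx : x ^ 5 = 1) : x = 1 := by
  have hx0 : x ≠ 0 := by rintro rfl; simp at hx
  have h1 := FiniteField.pow_card_sub_one_eq_one x hx0
  have hd : orderOf x ∣ Nat.gcd 5 (Fintype.card F - 1) :=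
    Nat.dvd_gcd (orderOf_dvd_of_pow_eq_one hx) (orderOf_dvd_of_pow_eq_one h1)
  have : Nat.gcd 5 (Fintype.card F - 1) = 1 := by
    rw [← Nat.Coprime, Nat.Prime.coprime_iff_not_dvd Nat.prime_five]
    omega
  rw [this] at hd
  exact orderOf_eq_one_iff.1 (Nat.dvd_one.1 hd)

theorem five_dvd_card_GL_two (F : Type*) [Field F] [Fintype F]
    (h : Fintype.card F % 5 = 4) : 5 ∣ Nat.card (GL (Fin 2) F) := by
  rw [Matrix.card_GL_field]
  simp only [Fin.prod_univ_two]
  apply Dvd.dvd.mul_right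
  simp only [Fin.val_zero, pow_zero]
  rw [← Nat.one_pow 2, Nat.sq_sub_sq]
  apply Dvd.dvd.mul_right
  omega

/-- If `q ≡ −1 (mod 5)`, then `K_5(GL_2(F_q)) = ℚ(√5)`. -/
theorem statement15 (p n q : ℕ) (hp : p.Prime) (hn : 1 ≤ n) (hq : q = p ^ n)
    (hcong : (q : ZMod 5) = -1)
    (F : Type) [Field F] [Fintype F] (hF : Fintype.card F = q) :
    charFieldAt (GL (Fin 2) F) 5 =
      IntermediateField.adjoin ℚ {(Real.sqrt 5 : ℂ)} := by
  subst hF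
  have hmod : Fintype.card F % 5 = 4 := by
    have : ((Fintype.card F : ℕ) : ZMod 5) = (4 : ℕ) := by rw [hcong]; decide
    exact (ZMod.natCast_eq_natCast_iff' _ _ _).1 this
  have h5 := five_ne_zero_of_card_mod_five F hmod
  have hroot := eq_one_of_pow_five_eq_one F hmod
  have hdvd := five_dvd_card_GL_two F hmod
  have char_form (V : FDRep ℂ (GL (Fin 2) F)) (g : GL (Fin 2) F) (hg : orderOf g = 5) :
      ∃ a b : ℚ, V.character g = a + b * (Real.sqrt 5 : ℂ) ∧
        V.character (g ^ 2) = a - b * (Real.sqrt 5 : ℂ) := by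
    have hg5 : g ^ 5 = 1 := hg ▸ pow_orderOf_eq_one g
    obtain ⟨⟨h, hh⟩, -⟩ := conj_inv_and_not_conj_sq_of_orderOf_eq_five h5 hroot g hg
    have h4 : g ^ 4 = h * g * h⁻¹ := by
      rw [hh, eq_inv_iff_mul_eq_one, ← pow_succ, hg5]
    have h3 : g ^ 3 = h * g ^ 2 * h⁻¹ := by
      rw [← conj_pow, hh, inv_pow, eq_inv_iff_mul_eq_one, ← pow_add, hg5]
    have := exists_trace_eq_add_mul_sqrt_five (V.ρ g) (by rw [← map_pow, hg5, map_one])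
      (by rw [← map_pow, h4]; exact V.char_conj g h)
      (by rw [← map_pow, ← map_pow, h3]; exact V.char_conj (g ^ 2) h)
    rwa [← map_pow] at this
  apply le_antisymm
  · refine IntermediateField.adjoin_le_iff.2 ?_
    rintro _ ⟨V, -, g, hg, rfl⟩
    obtain ⟨a, b, hab, -⟩ := char_form V g hg
    rw [hab]
    exact add_mem (SubfieldClass.ratCast_mem _ a)
      (mul_mem (SubfieldClass.ratCast_mem _ b) (IntermediateField.mem_adjoin_simple_self ℚ _))
  · rw [IntermediateField.adjoin_simple_le_iff]
    have := Fact.mk Nat.prime_five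
    obtain ⟨g, hg⟩ := exists_prime_orderOf_dvd_card' 5 hdvd
    have : Fintype (GL (Fin 2) F) := Fintype.ofFinite _
    by_contra hmem
    have heq (V : FDRep ℂ (GL (Fin 2) F)) (hV : Simple V) :
        V.character g = V.character (g ^ 2) := by
      obtain ⟨a, b, h1, h2⟩ := char_form V g hg
      by_cases hb : b = 0
      · simp [h1, h2, hb]
      · refine absurd ?_ hmem
        have hb' : (b : ℂ) ≠ 0 := by exact_mod_cast hb
        have hχ : V.character g ∈ charFieldAt (GL (Fin 2) F) 5 :=
          IntermediateField.subset_adjoin _ _ ⟨V, hV, g, hg, rfl⟩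
        have : (Real.sqrt 5 : ℂ) = (V.character g - a) / b := by
          rw [h1]; field_simp; ring
        rw [this]
        exact div_mem (sub_mem hχ (SubfieldClass.ratCast_mem _ a)) (SubfieldClass.ratCast_mem _ b)
    obtain ⟨x, hx⟩ := exists_conj_eq_of_forall_character_eq g (g ^ 2) heq
    exact (conj_inv_and_not_conj_sq_of_orderOf_eq_five h5 hroot g hg).2 x hx
end

section
/- Let p be an odd prime and q = p^n. Then K_8(GL_2(F_q)) = ℚ(ζ_8) if q ≡ 1 (mod 8); K_8(GL_2(F_q)) = ℚ(√−2) if q ≡ 3 (mod 8); K_8(GL_2(F_q)) = ℚ(i) if q ≡ 5 (mod 8); and K_8(GL_2(F_q)) = ℚ(√2) if q ≡ 7 (mod 8). -/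
open CategoryTheory

lemma trace_comp_pow_eq_sum {V : Type*} [AddCommGroup V] [Module ℂ V] [FiniteDimensional ℂ V]
    {N : ℕ} (hN : N ≠ 0) (T : Module.End ℂ V) (hT : T ^ N = 1) :
    ∃ s : Finset ℂ, (∀ μ ∈ s, μ ^ N = 1) ∧ ∀ (S : Module.End ℂ V) (h : Commute T S) (k : ℕ),
      LinearMap.trace ℂ V (S * T ^ k) = ∑ μ ∈ s, μ ^ k * LinearMap.trace ℂ (T.eigenspace μ)
        (S.restrict (Module.End.mapsTo_genEigenspace_of_comm h μ 1)) := by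
  classical
  have hss : T.IsSemisimple := by
    refine Module.End.isSemisimple_of_squarefree_aeval_eq_zero
      (p := (Polynomial.X ^ N - 1 : Polynomial ℂ)) ?_ (by simp [hT])
    exact (Polynomial.X_pow_sub_one_separable_iff.2 (by exact_mod_cast hN)).squarefree
  have htop : ⨆ μ, T.eigenspace μ = ⊤ := by
    simpa only [hss.isFinitelySemisimple.maxGenEigenspace_eq_eigenspace] using
      Module.End.iSup_maxGenEigenspace_eq_top T
  have hint := DirectSum.isInternal_submodule_of_iSupIndep_of_iSup_eq_top
      T.eigenspaces_iSupIndep htop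
  have hfin : {μ | T.eigenspace μ ≠ ⊥}.Finite :=
      WellFoundedGT.finite_ne_bot_of_iSupIndep T.eigenspaces_iSupIndep
  have hpow : ∀ (μ : ℂ) (k : ℕ) (v : V), v ∈ T.eigenspace μ → (T ^ k) v = μ ^ k • v := by
    intro μ k v hv
    rw [Module.End.mem_eigenspace_iff] at hv
    induction k with
    | zero => simp
    | succ k ih => rw [pow_succ', Module.End.mul_apply, ih, map_smul, hv, smul_smul, pow_succ]
  refine ⟨hfin.toFinset, fun μ hμ => ?_, fun S h k => ?_⟩
  · obtain ⟨v, hv, hv0⟩ := (Submodule.ne_bot_iff _).1 (hfin.mem_toFinset.1 hμ)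
    have h1 := hpow μ N v hv
    rw [hT, Module.End.one_apply] at h1
    exact smul_left_injective ℂ hv0 (by simpa using h1.symm)
  · have hS := Module.End.mapsTo_genEigenspace_of_comm h
    have hm : ∀ μ, Set.MapsTo (S * T ^ k) (T.eigenspace μ) (T.eigenspace μ) := fun μ =>
      Module.End.mapsTo_genEigenspace_of_comm (h.mul_right (Commute.refl T |>.pow_right k)) μ 1
    rw [LinearMap.trace_eq_sum_trace_restrict' hint hfin hm]
    refine Finset.sum_congr rfl fun μ _ => ?_
    have hres : (S * T ^ k).restrict (hm μ) = μ ^ k • S.restrict (hS μ 1) := by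
      ext v
      change S ((T ^ k) v) = μ ^ k • S v
      rw [hpow μ k v v.2, map_smul]
    exact (congrArg _ hres).trans (map_smul _ _ _)

lemma character_mem_of_simple {G : Type} [Group G] [Finite G] {g : G}
    (L : IntermediateField ℚ ℂ)
    (hL : ∀ V : FDRep ℂ G, Simple V → V.character g ∈ L) {V : Type} [AddCommGroup V] [Module ℂ V]
    [FiniteDimensional ℂ V] (ρ : Representation ℂ G V) : ρ.character g ∈ L := by
  have : Fintype G := Fintype.ofFinite G
  have : Invertible (Nat.card G : ℂ) := invertibleOfNonzero (by simp)
  have : NeZero (Nat.card G : ℂ) := ⟨by simp⟩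
  induction hn : Module.finrank ℂ V using Nat.strong_induction_on generalizing V with
  | _ n ih =>
  by_cases hV : Subsingleton V
  · have : ρ g = 0 := Subsingleton.elim _ _
    simp [Representation.character, this]
  rw [not_subsingleton_iff_nontrivial] at hV
  by_cases hirr : ρ.IsIrreducible
  · refine hL (FDRep.of ρ) ((FDRep.simple_iff_char_is_norm_one _).2 ?_)
    have := Representation.char_orthonormal ρ ρ
    rw [if_pos ⟨Representation.Equiv.refl ρ⟩, inv_mul_eq_one₀ (by simp)] at this
    exact this.symm
  · have hnt : Nontrivial (Subrepresentation ρ) := by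
      refine ⟨⊥, ⊤, fun h => ?_⟩
      have := congrArg Subrepresentation.toSubmodule h
      exact bot_ne_top this
    obtain ⟨σ, hσ⟩ : ∃ σ : Subrepresentation ρ, σ ≠ ⊥ ∧ σ ≠ ⊤ := by
      by_contra! h
      exact hirr ⟨fun σ => or_iff_not_imp_left.2 (h σ)⟩
    obtain ⟨τ, hτ⟩ := exists_isCompl σ
    have hc : IsCompl σ.toSubmodule τ.toSubmodule := by
      constructor
      · rw [disjoint_iff, ← Subrepresentation.toSubmodule_inf, hτ.inf_eq_bot]; rfl
      · rw [codisjoint_iff, ← Subrepresentation.toSubmodule_sup, hτ.sup_eq_top]; rfl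
    have hsum : ρ.character g =
        σ.toRepresentation.character g + τ.toRepresentation.character g := by
      let N : Bool → Submodule ℂ V := fun b => cond b σ.toSubmodule τ.toSubmodule
      have hN : DirectSum.IsInternal N := by
        rw [DirectSum.isInternal_submodule_iff_isCompl N (i := true) (j := false) (by simp)]
        · exact hc
        · ext b; cases b <;> simp
      have hm : ∀ b, Set.MapsTo (ρ g) (N b) (N b) := by
        rintro (_ | _)
        · exact τ.apply_mem_toSubmodule g
        · exact σ.apply_mem_toSubmodule g
      rw [Representation.character, LinearMap.trace_eq_sum_trace_restrict hN hm, Fintype.sum_bool]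
      rfl
    have hadd := Submodule.finrank_add_eq_of_isCompl hc
    have h1 : σ.toSubmodule ≠ ⊥ := fun h => hσ.1 (Subrepresentation.toSubmodule_injective h)
    have h2 : σ.toSubmodule ≠ ⊤ := fun h => hσ.2 (Subrepresentation.toSubmodule_injective h)
    have h3 := Submodule.one_le_finrank_iff.2 h1
    have h4 := Submodule.finrank_lt h2
    rw [hsum]
    exact L.add_mem (ih _ (by omega) _ rfl) (ih _ (by omega) _ rfl)

lemma trace_funLeft_s16 {X : Type*} [Fintype X] [DecidableEq X] (σ : X → X) :
    LinearMap.trace ℂ (X → ℂ) (LinearMap.funLeft ℂ ℂ σ) =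
      (Finset.univ.filter fun x => σ x = x).card := by
  rw [LinearMap.trace_eq_matrix_trace ℂ (Pi.basisFun ℂ X), Matrix.trace]
  simp [LinearMap.funLeft_apply, Pi.single_apply]

/-- Characters of finite-dimensional complex representations separate conjugacy classes. -/
lemma isConj_of_forall_character_eq {G : Type} [Group G] [Finite G] {g h : G}
    (H : ∀ (V : Type) [AddCommGroup V] [Module ℂ V] [FiniteDimensional ℂ V]
      (ρ : Representation ℂ G V), ρ.character g = ρ.character h) : IsConj g h := by
  classical
  have : Fintype G := Fintype.ofFinite G
  let R : G →* Module.End ℂ (G → ℂ) :=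
    { toFun c := LinearMap.funLeft ℂ ℂ (· * c)
      map_one' := by ext; simp [LinearMap.funLeft_apply]
      map_mul' a b := by ext; simp [LinearMap.funLeft_apply, mul_assoc] }
  let L : Representation ℂ G (G → ℂ) :=
    { toFun a := LinearMap.funLeft ℂ ℂ (a⁻¹ * ·)
      map_one' := by ext; simp [LinearMap.funLeft_apply]
      map_mul' a b := by ext; simp [LinearMap.funLeft_apply, mul_assoc] }
  have hcomm : ∀ a, Commute (R g) (L a) := fun a => by
    ext; simp [R, L, LinearMap.funLeft_apply, mul_assoc]
  obtain ⟨s, -, hs⟩ := trace_comp_pow_eq_sum (orderOf_pos g).ne' (R g)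
    (by rw [← map_pow, pow_orderOf_eq_one, map_one])
  let W (μ : ℂ) : Subrepresentation L :=
    ⟨(R g).eigenspace μ, fun a v hv => Module.End.mapsTo_genEigenspace_of_comm (hcomm a) μ 1 hv⟩
  have key : LinearMap.trace ℂ _ (L g * R g) = LinearMap.trace ℂ _ (L h * R g) := by
    have h1 := hs (L g) (hcomm g) 1
    have h2 := hs (L h) (hcomm h) 1
    rw [pow_one] at h1 h2
    rw [h1, h2]
    exact Finset.sum_congr rfl fun μ _ => congrArg _ (H _ (W μ).toRepresentation)
  have htr : ∀ a, LinearMap.trace ℂ _ (L a * R g) =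
      (Finset.univ.filter fun x => a⁻¹ * x * g = x).card := fun a =>
    trace_funLeft_s16 fun x => a⁻¹ * x * g
  rw [htr, htr, Nat.cast_inj] at key
  have hne : (Finset.univ.filter fun x => h⁻¹ * x * g = x).Nonempty := by
    rw [← Finset.card_pos, ← key, Finset.card_pos]
    exact ⟨1, by simp⟩
  obtain ⟨x, hx⟩ := hne
  rw [Finset.mem_filter] at hx
  refine isConj_iff.2 ⟨x, ?_⟩
  have := hx.2
  rw [mul_assoc, inv_mul_eq_iff_eq_mul] at this
  rw [this, mul_inv_cancel_right]

lemma character_mem_charFieldAt {G : Type} [Group G] [Finite G] {d : ℕ} {g : G}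
    (hg : orderOf g = d) {V : Type} [AddCommGroup V] [Module ℂ V]
    [FiniteDimensional ℂ V] (ρ : Representation ℂ G V) : ρ.character g ∈ charFieldAt G d :=
  character_mem_of_simple _
    (fun V hV => by
      rw [charFieldAt]
      exact IntermediateField.subset_adjoin ℚ _ ⟨V, hV, g, hg, rfl⟩) ρ

/-- The values of a character on the powers of an element of finite order, as sums of powers of
eigenvalues. -/
lemma character_pow_eq_sum {G : Type*} [Group G] {V : Type*} [AddCommGroup V] [Module ℂ V]
    [FiniteDimensional ℂ V] (ρ : Representation ℂ G V) {g : G} {N : ℕ} (hN : N ≠ 0)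
    (hg : g ^ N = 1) :
    ∃ (s : Finset ℂ) (m : ℂ → ℕ), (∀ μ ∈ s, μ ^ N = 1) ∧
      ∀ k : ℕ, ρ.character (g ^ k) = ∑ μ ∈ s, m μ * μ ^ k := by
  obtain ⟨s, hs, h⟩ := trace_comp_pow_eq_sum hN (ρ g) (by rw [← map_pow, hg, map_one])
  refine ⟨s, fun μ => Module.finrank ℂ (Module.End.eigenspace (ρ g) μ), hs, fun k => ?_⟩
  have hk := h 1 (Commute.one_right _) k
  rw [one_mul, ← map_pow] at hk
  rw [Representation.character, hk]
  refine Finset.sum_congr rfl fun μ _ => ?_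
  rw [mul_comm]
  exact congrArg (· * μ ^ k) (LinearMap.trace_one ℂ (Module.End.eigenspace (ρ g) μ))

lemma character_eq_of_isConj {G V : Type*} [Group G] [AddCommGroup V] [Module ℂ V]
    [FiniteDimensional ℂ V] (ρ : Representation ℂ G V) {g h : G} (hc : IsConj g h) :
    ρ.character g = ρ.character h := by
  obtain ⟨c, rfl⟩ := isConj_iff.1 hc
  exact (ρ.char_conj g c).symm

lemma charFieldAt_le {G : Type} [Group G] {d : ℕ} (hd : d ≠ 0) (k : ℕ)
    (hconj : ∀ g : G, orderOf g = d → IsConj g (g ^ k)) (L : IntermediateField ℚ ℂ)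
    (hL : ∀ μ : ℂ, μ ^ d = 1 → μ + μ ^ k ∈ L) : charFieldAt G d ≤ L := by
  refine IntermediateField.adjoin_le_iff.2 ?_
  rintro _ ⟨V, -, g, hg, rfl⟩
  obtain ⟨s, m, hs, h⟩ := character_pow_eq_sum V.ρ hd (hg ▸ pow_orderOf_eq_one g)
  have h1 := h 1
  have h2 := h k
  rw [← character_eq_of_isConj V.ρ (hconj g hg)] at h2
  rw [pow_one] at h1
  have h3 : Representation.character V.ρ g = (2 : ℚ)⁻¹ • ∑ μ ∈ s, m μ * (μ + μ ^ k) := by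
    have h4 : ∑ μ ∈ s, m μ * (μ + μ ^ k) = 2 * Representation.character V.ρ g := by
      simp only [mul_add, Finset.sum_add_distrib, ← h2]
      rw [two_mul]
      congr 1
      rw [h1]
      simp
    rw [h4, Rat.smul_def]
    push_cast
    ring
  change Representation.character V.ρ g ∈ L
  rw [h3]
  exact L.smul_mem (L.sum_mem fun μ hμ => L.mul_mem (natCast_mem L _) (hL μ (hs μ hμ)))

lemma pow_four_eq_one_or_eq_neg_one {μ : ℂ} (h : μ ^ 8 = 1) : μ ^ 4 = 1 ∨ μ ^ 4 = -1 :=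
  sq_eq_sq_iff_eq_or_eq_neg.1 (by rw [← pow_mul, one_pow]; exact h)

lemma mem_charFieldAt_eight {G : Type} [Group G] [Finite G] {k : ℕ} (hk : Odd k) {g : G}
    (hg : orderOf g = 8) (hconj : IsConj g (g ^ k)) (hnc : ¬ IsConj g (g ^ 5)) {w : ℂ}
    (hw : ∀ μ : ℂ, μ ^ 4 = -1 → μ + μ ^ k = w ∨ μ + μ ^ k = -w) : w ∈ charFieldAt G 8 := by
  have hconj5 : IsConj (g ^ 5) (g ^ (k * 5)) := by rw [pow_mul]; exact hconj.pow 5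
  have ho5 : orderOf (g ^ 5) = 8 := by rw [orderOf_pow, hg]; rfl
  contrapose! hnc
  refine isConj_of_forall_character_eq fun V _ _ _ ρ => ?_
  obtain ⟨s, m, hs, h⟩ := character_pow_eq_sum ρ (N := 8) (by norm_num)
    (hg ▸ pow_orderOf_eq_one g)
  have h1 := h 1
  have h5 := h 5
  have hk1 := h k
  have hk5 := h (k * 5)
  rw [← character_eq_of_isConj ρ hconj] at hk1
  rw [← character_eq_of_isConj ρ hconj5] at hk5
  simp only [pow_one] at h1
  have hdiff : 2 * (ρ.character g - ρ.character (g ^ 5)) =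
      ∑ μ ∈ s, m μ * (μ + μ ^ k - μ ^ 5 - μ ^ (k * 5)) := by
    simp only [mul_add, mul_sub, Finset.sum_add_distrib, Finset.sum_sub_distrib, ← h1, ← h5,
      ← hk1, ← hk5]
    ring
  have hspan : 2 * (ρ.character g - ρ.character (g ^ 5)) ∈ Submodule.span ℚ {w} := by
    rw [hdiff]
    refine Submodule.sum_mem _ fun μ hμ => ?_
    rcases pow_four_eq_one_or_eq_neg_one (hs μ hμ) with h4 | h4
    · have e5 : μ ^ 5 = μ := by rw [pow_succ, h4, one_mul]
      have : (m μ : ℂ) * (μ + μ ^ k - μ ^ 5 - μ ^ (k * 5)) = 0 := by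
        rw [mul_comm k, pow_mul, e5]; ring
      rw [this]
      exact Submodule.zero_mem _
    · have e5 : μ ^ 5 = -μ := by rw [pow_succ, h4]; ring
      have e : μ + μ ^ k - μ ^ 5 - μ ^ (k * 5) = 2 * (μ + μ ^ k) := by
        rw [mul_comm k, pow_mul, e5, hk.neg_pow]; ring
      rw [e, Submodule.mem_span_singleton]
      rcases hw μ h4 with h | h
      · exact ⟨m μ * 2, by rw [h, Rat.smul_def]; push_cast; ring⟩
      · exact ⟨-(m μ * 2), by rw [h, Rat.smul_def]; push_cast; ring⟩
  obtain ⟨r, hr⟩ := Submodule.mem_span_singleton.1 hspan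
  have hmem : r • w ∈ charFieldAt G 8 := by
    rw [hr]
    exact mul_mem (ofNat_mem _ 2)
      (sub_mem (character_mem_charFieldAt hg ρ) (character_mem_charFieldAt ho5 ρ))
  by_cases hr0 : r = 0
  · rw [hr0, zero_smul] at hr
    have := mul_eq_zero.1 hr.symm
    exact sub_eq_zero.1 (this.resolve_left two_ne_zero)
  · refine absurd ?_ hnc
    have := (charFieldAt G 8).smul_mem (x := r⁻¹) hmem
    rwa [smul_smul, inv_mul_cancel₀ hr0, one_smul] at this

lemma monoidHom_apply_mem_charFieldAt {G : Type} [Group G] [Finite G] {d : ℕ} {g : G}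
    (hg : orderOf g = d) (χ : G →* ℂ) : χ g ∈ charFieldAt G d := by
  let ρ : Representation ℂ G ℂ := (algebraMap ℂ (Module.End ℂ ℂ)).toMonoidHom.comp χ
  have h : ρ.character g = χ g := by
    have : ρ g = χ g • (1 : Module.End ℂ ℂ) :=
      Algebra.algebraMap_eq_smul_one (χ g)
    rw [Representation.character, this, map_smul, LinearMap.trace_one]
    simp
  exact h ▸ character_mem_charFieldAt hg ρ

/-- A multiplicative character of a finite field, not trivial at `a`, gives a value of a linear
character of `GL₂`. -/
lemma exists_mem_charFieldAt_det {F : Type} [Field F] [Finite F] {d : ℕ} {g : GL (Fin 2) F}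
    (hg : orderOf g = d) {k : ℕ} (ha : g.det ^ k ≠ 1) :
    ∃ z : ℂ, z ∈ charFieldAt (GL (Fin 2) F) d ∧ z ^ k ≠ 1 ∧
      ∀ n : ℕ, g.det ^ n = 1 → z ^ n = 1 := by
  obtain ⟨χ, hχ⟩ := CommGroup.exists_apply_ne_one_of_hasEnoughRootsOfUnity Fˣ ℂ ha
  refine ⟨_, monoidHom_apply_mem_charFieldAt hg
    (((Units.coeHom ℂ).comp χ).comp Matrix.GeneralLinearGroup.det), fun h => hχ ?_, fun n hn => ?_⟩
  · ext
    simpa using h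
  · have := congrArg χ hn
    rw [map_pow, map_one, Units.ext_iff] at this
    simpa using this

section Conjugacy

variable {F : Type*} [Field F]

/-- A non-scalar `2 × 2` matrix is similar to the companion matrix of its characteristic
polynomial. -/
lemma exists_mul_eq_mul_companion (A : Matrix (Fin 2) (Fin 2) F)
    (hA : ∀ c : F, A ≠ Matrix.scalar (Fin 2) c) :
    ∃ P : GL (Fin 2) F, A * P.val = P.val * !![0, -A.det; 1, A.trace] := by
  obtain ⟨x, y, hxy⟩ : ∃ x y : F,
      (!![x, A 0 0 * x + A 0 1 * y; y, A 1 0 * x + A 1 1 * y]).det ≠ 0 := by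
    by_contra! h
    have h1 := h 1 0
    have h2 := h 0 1
    have h3 := h 1 1
    simp [Matrix.det_fin_two] at h1 h2 h3
    refine hA (A 0 0) ?_
    ext i j
    fin_cases i <;> fin_cases j <;> simp [h1, h2]
    rw [h1, h2] at h3
    linear_combination h3
  refine ⟨Matrix.GeneralLinearGroup.mkOfDetNeZero _ hxy, ?_⟩
  ext i j
  fin_cases i <;> fin_cases j <;>
    simp [Matrix.GeneralLinearGroup.mkOfDetNeZero, Matrix.mul_apply, Fin.sum_univ_two,
      Matrix.det_fin_two, Matrix.trace_fin_two] <;> ring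

lemma isConj_of_trace_eq_of_det_eq {g h : GL (Fin 2) F}
    (hg : ∀ c : F, g.val ≠ Matrix.scalar (Fin 2) c) (hh : ∀ c : F, h.val ≠ Matrix.scalar (Fin 2) c)
    (htr : g.val.trace = h.val.trace) (hdet : g.val.det = h.val.det) : IsConj g h := by
  obtain ⟨P, hP⟩ := exists_mul_eq_mul_companion g.val hg
  obtain ⟨Q, hQ⟩ := exists_mul_eq_mul_companion h.val hh
  rw [htr, hdet] at hP
  refine isConj_iff.2 ⟨Q * P⁻¹, ?_⟩
  have hC : P⁻¹ * g * P = Q⁻¹ * h * Q := by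
    ext1
    have e1 : (P⁻¹ * g * P).val = P⁻¹.val * (g.val * P.val) := by simp [mul_assoc]
    have e2 : (Q⁻¹ * h * Q).val = Q⁻¹.val * (h.val * Q.val) := by simp [mul_assoc]
    rw [e1, e2, hP, hQ, ← mul_assoc, ← mul_assoc, Units.inv_mul, Units.inv_mul]
  calc Q * P⁻¹ * g * (Q * P⁻¹)⁻¹ = Q * (P⁻¹ * g * P) * Q⁻¹ := by group
    _ = h := by rw [hC]; group

lemma ne_scalar_of_orderOf_not_dvd [Fintype F] {g : GL (Fin 2) F}
    (hg : ¬ orderOf g ∣ Fintype.card F - 1) (c : F) : g.val ≠ Matrix.scalar (Fin 2) c := by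
  intro hc
  have hc0 : c ≠ 0 := by
    rintro rfl
    rw [map_zero] at hc
    exact g.isUnit.ne_zero hc
  refine hg (orderOf_dvd_of_pow_eq_one ?_)
  ext1
  rw [Units.val_pow_eq_pow_val, hc, ← map_pow, FiniteField.pow_card_sub_one_eq_one c hc0, map_one,
    Units.val_one]

lemma isConj_pow_card [Fintype F] {g : GL (Fin 2) F} {k : ℕ}
    (hd : ¬ orderOf g ∣ Fintype.card F - 1) (hk : Fintype.card F ≡ k [MOD orderOf g])
    (hcop : (orderOf g).Coprime k) : IsConj g (g ^ k) := by
  have ho : orderOf (g ^ k) = orderOf g := hcop.orderOf_pow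
  have hcp : ((g ^ k).val).charpoly = g.val.charpoly := by
    rw [← pow_eq_pow_iff_modEq.2 hk, Units.val_pow_eq_pow_val, FiniteField.Matrix.charpoly_pow_card]
  refine isConj_of_trace_eq_of_det_eq (ne_scalar_of_orderOf_not_dvd hd)
    (ne_scalar_of_orderOf_not_dvd (ho ▸ hd)) ?_ ?_
  · rw [Matrix.trace_eq_neg_charpoly_coeff, Matrix.trace_eq_neg_charpoly_coeff, hcp]
  · rw [Matrix.det_eq_sign_charpoly_coeff, Matrix.det_eq_sign_charpoly_coeff, hcp]

lemma exists_orderOf_eq_eight (h2 : (2 : F) ≠ 0) {M : Matrix (Fin 2) (Fin 2) F}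
    (hM : M ^ 4 = -1) : ∃ g : GL (Fin 2) F, g.val = M ∧ orderOf g = 8 := by
  have hdet : M.det ≠ 0 := fun h => by
    have := congrArg Matrix.det hM
    rw [Matrix.det_pow, h] at this
    simp [Matrix.det_neg] at this
  refine ⟨Matrix.GeneralLinearGroup.mkOfDetNeZero M hdet, rfl, ?_⟩
  refine orderOf_eq_prime_pow (p := 2) (n := 2) (fun h => ?_) ?_
  · have h := congrArg Units.val h
    rw [Units.val_pow_eq_pow_val] at h
    replace h := hM.symm.trans h
    have := congrFun₂ h 0 0
    simp at this
    exact h2 (by linear_combination -this)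
  · ext1
    rw [Units.val_pow_eq_pow_val]
    change M ^ (4 * 2) = 1
    rw [pow_mul, hM]
    simp

lemma not_isConj_pow_five (h2 : (2 : F) ≠ 0) {g : GL (Fin 2) F} (hg : g.val ^ 4 = -1)
    (htr : g.val.trace ≠ 0) : ¬ IsConj g (g ^ 5) := by
  intro h
  obtain ⟨c, hc⟩ := isConj_iff.1 h
  have h5 : (g ^ 5).val = -g.val := by
    rw [Units.val_pow_eq_pow_val, pow_succ, hg, neg_one_mul]
  have := congrArg (fun x : GL (Fin 2) F => x.val.trace) hc
  simp only [h5, Units.val_mul, Matrix.trace_neg] at this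
  rw [Matrix.trace_mul_comm, ← mul_assoc, Units.inv_mul, one_mul] at this
  exact htr ((mul_eq_zero.1 (show 2 * g.val.trace = 0 by linear_combination this)).resolve_left h2)

end Conjugacy

lemma sq_eq_one_or_eq_neg_one_of_pow_four {μ : ℂ} (h : μ ^ 4 = 1) : μ ^ 2 = 1 ∨ μ ^ 2 = -1 :=
  sq_eq_sq_iff_eq_or_eq_neg.1 (by rw [← pow_mul, one_pow]; exact h)

lemma sqrt_two_sq : ((Real.sqrt 2 : ℝ) : ℂ) ^ 2 = 2 := by
  rw [← Complex.ofReal_pow, Real.sq_sqrt (by norm_num)]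
  norm_num

lemma add_pow_three_of_pow_four_eq_neg_one {μ : ℂ} (h : μ ^ 4 = -1) :
    μ + μ ^ 3 = (Real.sqrt 2 : ℂ) * Complex.I ∨ μ + μ ^ 3 = -((Real.sqrt 2 : ℂ) * Complex.I) := by
  refine sq_eq_sq_iff_eq_or_eq_neg.1 ?_
  rw [mul_pow, sqrt_two_sq, Complex.I_sq]
  linear_combination (μ ^ 2 + 2) * h

lemma add_pow_seven_of_pow_four_eq_neg_one {μ : ℂ} (h : μ ^ 4 = -1) :
    μ + μ ^ 7 = (Real.sqrt 2 : ℂ) ∨ μ + μ ^ 7 = -(Real.sqrt 2 : ℂ) := by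
  refine sq_eq_sq_iff_eq_or_eq_neg.1 ?_
  rw [sqrt_two_sq]
  linear_combination (μ ^ 10 - μ ^ 6 + μ ^ 2 + 2 * μ ^ 4 - 2) * h

lemma add_pow_mem_of_pow_four_eq_one {μ : ℂ} {k : ℕ} (hk : k % 4 = 3) (h : μ ^ 4 = 1)
    (L : IntermediateField ℚ ℂ) : μ + μ ^ k ∈ L := by
  have e : μ ^ k = μ ^ 2 * μ := by
    rw [← Nat.div_add_mod k 4, hk, pow_add, pow_mul, h, one_pow, one_mul, pow_succ]
  rw [e]
  rcases sq_eq_one_or_eq_neg_one_of_pow_four h with h2 | h2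
  · rcases sq_eq_sq_iff_eq_or_eq_neg.1 (h2.trans (one_pow 2).symm) with rfl | rfl
    · exact add_mem (one_mem L) (mul_mem (pow_mem (one_mem L) _) (one_mem L))
    · have := neg_mem (one_mem L)
      exact add_mem this (mul_mem (pow_mem this _) this)
  · rw [h2]
    simp

section FiniteField

variable {F : Type} [Field F] [Fintype F]

lemma two_ne_zero_of_card_odd (h : Fintype.card F % 2 = 1) : (2 : F) ≠ 0 :=
  Ring.two_ne_zero fun h2 => by
    have := FiniteField.even_card_of_char_two h2
    omega

lemma isConj_pow_of_orderOf_eq_eight {k : ℕ} (hk : Fintype.card F % 8 = k) (hodd : k % 2 = 1)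
    (hk1 : k ≠ 1) (g : GL (Fin 2) F) (hg : orderOf g = 8) : IsConj g (g ^ k) := by
  refine isConj_pow_card ?_ ?_ ?_
  · rw [hg]
    omega
  · rw [hg, ← hk]
    exact (Nat.mod_modEq _ _).symm
  · rw [hg]
    exact Nat.Coprime.pow_left 3 (Nat.coprime_two_left.2 (Nat.odd_iff.2 hodd))

lemma charFieldAt_eight_of_card_mod_eq_one (hq : Fintype.card F % 8 = 1) :
    charFieldAt (GL (Fin 2) F) 8 = IntermediateField.adjoin ℚ {zeta 8} := by
  have hζ : IsPrimitiveRoot (zeta 8) 8 := Complex.isPrimitiveRoot_exp 8 (by norm_num)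
  refine le_antisymm (charFieldAt_le (by norm_num) 1
    (fun g _ => (pow_one g).symm ▸ IsConj.refl g) _ fun μ hμ => ?_)
    (IntermediateField.adjoin_simple_le_iff.2 ?_)
  · obtain ⟨i, -, rfl⟩ := hζ.eq_pow_of_pow_eq_one hμ
    have := pow_mem (IntermediateField.mem_adjoin_simple_self ℚ (zeta 8)) i
    exact add_mem this (pow_mem this 1)
  · obtain ⟨u, hu⟩ := IsCyclic.exists_ofOrder_eq_natCard (α := Fˣ)
    have hdvd : 8 ∣ orderOf u := by
      rw [hu, Nat.card_units, Nat.card_eq_fintype_card]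
      omega
    obtain ⟨m, hm⟩ := hdvd
    have hm0 : m ≠ 0 := by
      rintro rfl
      exact (orderOf_pos u).ne' hm
    have ha : orderOf (u ^ m) = 8 := by
      rw [orderOf_pow_of_dvd hm0 ⟨8, by rw [hm, mul_comm]⟩, hm, Nat.mul_div_cancel _ (by omega)]
    set a := u ^ m
    have ha4 : a ^ 4 ≠ 1 := pow_ne_one_of_lt_orderOf (by norm_num) (by omega)
    have ha8 : a ^ 8 = 1 := ha ▸ pow_orderOf_eq_one a
    have hD : (Matrix.diagonal ![(a : F), 1]).det = a := by simp
    let g : GL (Fin 2) F :=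
      Matrix.GeneralLinearGroup.mkOfDetNeZero (Matrix.diagonal ![(a : F), 1]) (by simp)
    have hdet : g.det = a := by
      ext1
      exact hD
    have hg : orderOf g = 8 := by
      refine orderOf_eq_prime_pow (p := 2) (n := 2) (fun h => ha4 ?_) ?_
      · rw [← hdet, ← map_pow]
        exact (congrArg _ h).trans (map_one _)
      · ext1
        rw [Units.val_pow_eq_pow_val]
        change (Matrix.diagonal ![(a : F), 1]) ^ 8 = 1
        rw [Matrix.diagonal_pow, ← Matrix.diagonal_one]
        congr 1
        ext i
        fin_cases i
        · simpa using congrArg Units.val ha8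
        · simp
    obtain ⟨z, hz, hz4, hzn⟩ := exists_mem_charFieldAt_det hg (k := 4) (by rwa [hdet])
    have hz8 : orderOf z = 8 :=
      orderOf_eq_prime_pow (p := 2) (n := 2) hz4 (hzn 8 (by rw [hdet, ha8]))
    obtain ⟨i, -, hi⟩ := (IsPrimitiveRoot.iff_orderOf.2 hz8).eq_pow_of_pow_eq_one hζ.pow_eq_one
    exact hi ▸ pow_mem hz i

lemma charFieldAt_eight_of_card_mod_eq_five (hq : Fintype.card F % 8 = 5) :
    charFieldAt (GL (Fin 2) F) 8 = IntermediateField.adjoin ℚ {Complex.I} := by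
  have hI := IntermediateField.mem_adjoin_simple_self ℚ Complex.I
  refine le_antisymm (charFieldAt_le (by norm_num) 5
    (isConj_pow_of_orderOf_eq_eight hq rfl (by norm_num)) _ fun μ hμ => ?_)
    (IntermediateField.adjoin_simple_le_iff.2 ?_)
  · rcases pow_four_eq_one_or_eq_neg_one hμ with h | h
    · have hmem : μ ∈ IntermediateField.adjoin ℚ {Complex.I} := by
        rcases sq_eq_one_or_eq_neg_one_of_pow_four h with h2 | h2
        · rcases sq_eq_sq_iff_eq_or_eq_neg.1 (h2.trans (one_pow 2).symm) with rfl | rfl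
          · exact one_mem _
          · exact neg_mem (one_mem _)
        · rcases sq_eq_sq_iff_eq_or_eq_neg.1 (h2.trans Complex.I_sq.symm) with rfl | rfl
          · exact hI
          · exact neg_mem hI
      exact add_mem hmem (pow_mem hmem 5)
    · have : μ + μ ^ 5 = 0 := by linear_combination μ * h
      rw [this]
      exact zero_mem _
  · have h2 : (2 : F) ≠ 0 := two_ne_zero_of_card_odd (by omega)
    obtain ⟨i, hi⟩ := FiniteField.isSquare_neg_one_iff.2 (by omega : Fintype.card F % 4 ≠ 3)
    have hM : (!![0, i; 1, 0] : Matrix (Fin 2) (Fin 2) F) ^ 4 = -1 := by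
      ext a b
      fin_cases a <;> fin_cases b <;> simp [pow_succ, Matrix.mul_apply, Fin.sum_univ_two, ← hi]
    obtain ⟨g, hgM, hg⟩ := exists_orderOf_eq_eight h2 hM
    have hdet : g.det.val = -i := by
      rw [Matrix.GeneralLinearGroup.val_det_apply, hgM]
      simp
    have hdet2 : (g.det ^ 2).val = -1 := by
      rw [Units.val_pow_eq_pow_val, hdet]
      linear_combination -hi
    obtain ⟨z, hz, hz2, hzn⟩ := exists_mem_charFieldAt_det hg (k := 2) fun h => by
      rw [h, Units.val_one] at hdet2
      exact h2 (by linear_combination hdet2)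
    have hz4 := hzn 4 (by
      ext1
      rw [pow_mul _ 2 2, Units.val_pow_eq_pow_val, hdet2]
      simp)
    have hzI := ((sq_eq_one_or_eq_neg_one_of_pow_four hz4).resolve_left hz2).trans
      Complex.I_sq.symm
    rcases sq_eq_sq_iff_eq_or_eq_neg.1 hzI with rfl | rfl
    · exact hz
    · simpa using neg_mem hz

lemma charFieldAt_eight_of_card_mod_eq_three (hq : Fintype.card F % 8 = 3) :
    charFieldAt (GL (Fin 2) F) 8 =
      IntermediateField.adjoin ℚ {(Real.sqrt 2 : ℂ) * Complex.I} := by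
  have hw := IntermediateField.mem_adjoin_simple_self ℚ ((Real.sqrt 2 : ℂ) * Complex.I)
  have hconj := isConj_pow_of_orderOf_eq_eight hq rfl (by norm_num)
  refine le_antisymm (charFieldAt_le (by norm_num) 3 hconj _ fun μ hμ => ?_)
    (IntermediateField.adjoin_simple_le_iff.2 ?_)
  · rcases pow_four_eq_one_or_eq_neg_one hμ with h | h
    · exact add_pow_mem_of_pow_four_eq_one rfl h _
    · rcases add_pow_three_of_pow_four_eq_neg_one h with h | h <;> rw [h]
      · exact hw
      · exact neg_mem hw
  · have h2 : (2 : F) ≠ 0 := two_ne_zero_of_card_odd (by omega)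
    obtain ⟨s, hs⟩ := FiniteField.isSquare_neg_two_iff.2
      (by omega : Fintype.card F % 8 ≠ 5 ∧ Fintype.card F % 8 ≠ 7)
    have hs0 : s ≠ 0 := by
      rintro rfl
      exact h2 (by linear_combination -hs)
    have hM : (!![0, 1; 1, s] : Matrix (Fin 2) (Fin 2) F) ^ 4 = -1 := by
      ext a b
      fin_cases a <;> fin_cases b <;> simp [pow_succ, Matrix.mul_apply, Fin.sum_univ_two] <;> grind
    obtain ⟨g, hgM, hg⟩ := exists_orderOf_eq_eight h2 hM
    exact mem_charFieldAt_eight (by decide) hg (hconj g hg)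
      (not_isConj_pow_five h2 (hgM ▸ hM) (by rw [hgM]; simpa [Matrix.trace_fin_two] using hs0))
      fun μ => add_pow_three_of_pow_four_eq_neg_one

lemma charFieldAt_eight_of_card_mod_eq_seven (hq : Fintype.card F % 8 = 7) :
    charFieldAt (GL (Fin 2) F) 8 = IntermediateField.adjoin ℚ {(Real.sqrt 2 : ℂ)} := by
  have hw := IntermediateField.mem_adjoin_simple_self ℚ (Real.sqrt 2 : ℂ)
  have hconj := isConj_pow_of_orderOf_eq_eight hq rfl (by norm_num)
  refine le_antisymm (charFieldAt_le (by norm_num) 7 hconj _ fun μ hμ => ?_)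
    (IntermediateField.adjoin_simple_le_iff.2 ?_)
  · rcases pow_four_eq_one_or_eq_neg_one hμ with h | h
    · exact add_pow_mem_of_pow_four_eq_one rfl h _
    · rcases add_pow_seven_of_pow_four_eq_neg_one h with h | h <;> rw [h]
      · exact hw
      · exact neg_mem hw
  · have h2 : (2 : F) ≠ 0 := two_ne_zero_of_card_odd (by omega)
    obtain ⟨s, hs⟩ := FiniteField.isSquare_two_iff.2
      (by omega : Fintype.card F % 8 ≠ 3 ∧ Fintype.card F % 8 ≠ 5)
    have hs0 : s ≠ 0 := by
      rintro rfl
      exact h2 (by linear_combination hs)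
    have hM : (!![0, -1; 1, s] : Matrix (Fin 2) (Fin 2) F) ^ 4 = -1 := by
      ext a b
      fin_cases a <;> fin_cases b <;> simp [pow_succ, Matrix.mul_apply, Fin.sum_univ_two] <;> grind
    obtain ⟨g, hgM, hg⟩ := exists_orderOf_eq_eight h2 hM
    exact mem_charFieldAt_eight (by decide) hg (hconj g hg)
      (not_isConj_pow_five h2 (hgM ▸ hM) (by rw [hgM]; simpa [Matrix.trace_fin_two] using hs0))
      fun μ => add_pow_seven_of_pow_four_eq_neg_one

end FiniteField

/-- For `q = p^n` with `p` an odd prime, `K_8(GL_2(F_q))` equals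
`ℚ(ζ_8)` if `q ≡ 1 (mod 8)`, `ℚ(√−2)` if `q ≡ 3 (mod 8)`, `ℚ(i)` if `q ≡ 5 (mod 8)`,
and `ℚ(√2)` if `q ≡ 7 (mod 8)`. -/
theorem statement16 (p n q : ℕ) (hp : p.Prime) (hodd : Odd p) (hn : 1 ≤ n)
    (hq : q = p ^ n)
    (F : Type) [Field F] [Fintype F] (hF : Fintype.card F = q) :
    (q % 8 = 1 →
      charFieldAt (GL (Fin 2) F) 8 = IntermediateField.adjoin ℚ {zeta 8}) ∧
    (q % 8 = 3 →
      charFieldAt (GL (Fin 2) F) 8 =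
        IntermediateField.adjoin ℚ {(Real.sqrt 2 : ℂ) * Complex.I}) ∧
    (q % 8 = 5 →
      charFieldAt (GL (Fin 2) F) 8 = IntermediateField.adjoin ℚ {Complex.I}) ∧
    (q % 8 = 7 →
      charFieldAt (GL (Fin 2) F) 8 = IntermediateField.adjoin ℚ {(Real.sqrt 2 : ℂ)}) := by
  subst hF
  exact ⟨charFieldAt_eight_of_card_mod_eq_one, charFieldAt_eight_of_card_mod_eq_three,
    charFieldAt_eight_of_card_mod_eq_five, charFieldAt_eight_of_card_mod_eq_seven⟩
end
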